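/- arXiv:math/0307053 — 4 statements merged into one kernel-verified Lean document; each statement's English description precedes it below -/
import Mathlib

section
/- Let H be a subgroup of a finite group G and let J be the operator on functions on Irr(G) given by the kernel J(ρ,σ) = (|H|/|G|)·(dim σ/dim ρ)·Σ_{τ∈Irr(H)} κ(τ,ρ)κ(τ,σ). For each conjugacy class C of G, define ψ_C(ρ) = |C|^{1/2}·χ^ρ(C)/dim(ρ). Then ψ_C is an eigenfunction of J with eigenvalue |C ∩ H|/|C|. -/
open FDRep Module CategoryTheory

/-- `κ(τ,ρ)`: the multiplicity of the irreducible `τ` of `H` in the restriction of `ρ`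
from `G` to `H`. -/
noncomputable def kappa {G : Type} [Group G] (H : Subgroup G) [Fintype H]
    (τ : FDRep ℂ H) (ρ : FDRep ℂ G) : ℂ :=
  (Fintype.card H : ℂ)⁻¹ *
    ∑ h : H, (starRingEnd ℂ) (τ.character h) * ρ.character (h : G)

/-- A class function orthogonal to the character of an irreducible representation is sent to zero
by that representation. -/
lemma sum_smul_eq_zero_of_sum_mul_character_eq_zero {G V : Type*} [Group G] [Fintype G]
    [AddCommGroup V] [Module ℂ V] [FiniteDimensional ℂ V]
    (ρ : Representation ℂ G V) [ρ.IsIrreducible] {f : G → ℂ}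
    (hf : ∀ x y : G, f (y * x * y⁻¹) = f x) (h : ∑ x, f x * ρ.character x = 0) :
    ∑ x, f x • ρ x = 0 := by
  have hcomm (y : G) : (∑ x, f x • ρ x) ∘ₗ ρ y = ρ y ∘ₗ ∑ x, f x • ρ x := by
    rw [← Module.End.mul_eq_comp, ← Module.End.mul_eq_comp, Finset.sum_mul, Finset.mul_sum]
    refine Fintype.sum_equiv (MulAut.conj y⁻¹).toEquiv _ _ fun x ↦ ?_
    have hx : f (y⁻¹ * (x * y)) = f x := by simpa [mul_assoc] using hf x y⁻¹
    simp [hx, ← map_mul, mul_assoc]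
  let T : Representation.IntertwiningMap ρ ρ := ⟨∑ x, f x • ρ x, hcomm⟩
  obtain ⟨c, hc⟩ :=
    (Representation.IsIrreducible.algebraMap_intertwiningMap_bijective_of_isAlgClosed
      (ρ := ρ)).2 T
  have hT : ∑ x, f x • ρ x = c • LinearMap.id := by
    have := congrArg Representation.IntertwiningMap.toLinearMap hc
    rw [Algebra.algebraMap_eq_smul_one] at this
    exact this.symm
  have htr : c * finrank ℂ V = 0 := by
    rw [← h]
    have := congrArg (LinearMap.trace ℂ V) hT
    simp only [map_sum, map_smul, LinearMap.trace_id, smul_eq_mul] at this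
    exact this.symm
  rcases mul_eq_zero.1 htr with hc | hd
  · simp [hT, hc]
  · have : Subsingleton V := finrank_zero_iff.1 (Nat.cast_eq_zero.1 hd)
    exact Subsingleton.elim _ _

/-- An irreducible representation of a finite group yields a simple object of `FDRep`. -/
lemma simple_of_isIrreducible {G V : Type} [Group G] [Fintype G]
    [AddCommGroup V] [Module ℂ V] [FiniteDimensional ℂ V]
    (ρ : Representation ℂ G V) [ρ.IsIrreducible] : Simple (FDRep.of ρ) := by
  have : Invertible (Nat.card G : ℂ) := invertibleOfNonzero (NeZero.ne _)
  rw [FDRep.simple_iff_char_is_norm_one]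
  have h := Representation.char_orthonormal ρ ρ
  rw [if_pos ⟨Representation.Equiv.refl ρ⟩, inv_mul_eq_one₀ (NeZero.ne _)] at h
  exact h.symm

open scoped MonoidAlgebra in
/-- A class function orthogonal to all irreducible characters annihilates every simple module
over the group algebra. -/
lemma sum_single_smul_eq_zero_of_isSimpleModule {G ι : Type} [Group G] [Fintype G]
    (Irr : ι → FDRep ℂ G)
    (hcomplete : ∀ V : FDRep ℂ G, Simple V → ∃ i, Nonempty (V ≅ Irr i)) {f : G → ℂ}
    (hf : ∀ x y : G, f (y * x * y⁻¹) = f x)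
    (h : ∀ i, ∑ x, f x * (Irr i).character x = 0)
    (M : Type) [AddCommGroup M] [Module ℂ[G] M] [IsSimpleModule ℂ[G] M] (m : M) :
    (∑ x, MonoidAlgebra.single x (f x) : ℂ[G]) • m = 0 := by
  let := Module.restrictScalars ℂ ℂ[G] M
  have := IsScalarTower.restrictScalars ℂ ℂ[G] M
  let ρ : Representation ℂ G M := Representation.ofModule' M
  have hρ : ρ.asAlgebraHom = Algebra.lsmul ℂ ℂ M :=
    (MonoidAlgebra.lift ℂ (M →ₗ[ℂ] M) G).apply_symm_apply _
  let φ : ρ.asModule ≃ₗ[ℂ[G]] M :=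
    { ρ.asModuleEquiv with
      map_smul' := fun r x ↦ (ρ.asModuleEquiv_map_smul r x).trans (by rw [hρ]; rfl) }
  have hirr : ρ.IsIrreducible :=
    (Representation.irreducible_iff_isSimpleModule_asModule ρ).mpr (IsSimpleModule.congr φ)
  have : FiniteDimensional ℂ M := Module.Finite.trans ℂ[G] M
  obtain ⟨i, ⟨e⟩⟩ := hcomplete _ (simple_of_isIrreducible ρ)
  have hzero := sum_smul_eq_zero_of_sum_mul_character_eq_zero ρ hf (by
    rw [← h i, ← FDRep.char_iso e]; rfl)
  have hact : ρ.asAlgebraHom (∑ x, MonoidAlgebra.single x (f x)) = 0 := by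
    rw [map_sum, ← hzero]
    exact Finset.sum_congr rfl fun x _ ↦ ρ.asAlgebraHom_single x (f x)
  rw [hρ] at hact
  exact LinearMap.congr_fun hact m

open scoped MonoidAlgebra in
/-- A class function orthogonal to all irreducible characters vanishes. -/
lemma eq_zero_of_sum_mul_character_eq_zero {G ι : Type} [Group G] [Fintype G]
    (Irr : ι → FDRep ℂ G)
    (hcomplete : ∀ V : FDRep ℂ G, Simple V → ∃ i, Nonempty (V ≅ Irr i)) {f : G → ℂ}
    (hf : ∀ x y : G, f (y * x * y⁻¹) = f x)
    (h : ∀ i, ∑ x, f x * (Irr i).character x = 0) : f = 0 := by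
  have hz : (∑ x, MonoidAlgebra.single x (f x) : ℂ[G]) ∈ Ring.jacobson ℂ[G] := by
    refine Ideal.mem_sInf.mpr fun {I} hI ↦ ?_
    have : IsSimpleModule ℂ[G] (ℂ[G] ⧸ I) := isSimpleModule_iff_isCoatom.mpr hI
    have hI0 := sum_single_smul_eq_zero_of_isSimpleModule Irr hcomplete hf h (ℂ[G] ⧸ I)
      (Submodule.Quotient.mk 1)
    rwa [← Submodule.Quotient.mk_smul, smul_eq_mul, mul_one,
      Submodule.Quotient.mk_eq_zero] at hI0
  rw [IsSemisimpleRing.jacobson_eq_bot, Submodule.mem_bot] at hz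
  funext x
  classical
  simpa [MonoidAlgebra.coeff_sum, Finsupp.finsetSum_apply, Finsupp.single_apply] using
    congrArg (fun w : ℂ[G] ↦ w.coeff x) hz

open scoped Classical in
/-- Averaging a class function over a conjugacy class. -/
lemma sum_isConj_div_card_mul {G : Type*} [Group G] [Fintype G] {F : G → ℂ}
    (hF : ∀ x y : G, F (y * x * y⁻¹) = F x) (c : ℂ) (g : G) :
    ∑ x, (if IsConj g x then c / Nat.card {y : G // IsConj g y} else 0) * F x = c * F g := by
  have hcard : (Nat.card {y : G // IsConj g y} : ℂ) ≠ 0 := by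
    have : Nonempty {y : G // IsConj g y} := ⟨⟨g, IsConj.refl g⟩⟩
    exact Nat.cast_ne_zero.2 Nat.card_pos.ne'
  have hconj (x : G) : (if IsConj g x then c / Nat.card {y : G // IsConj g y} else 0) * F x =
      if IsConj g x then c / Nat.card {y : G // IsConj g y} * F g else 0 := by
    split_ifs with hx
    · obtain ⟨y, rfl⟩ := isConj_iff.1 hx
      rw [hF]
    · rw [zero_mul]
  simp only [hconj]
  rw [← Finset.sum_filter, Finset.sum_const, nsmul_eq_mul, ← Fintype.card_subtype,
    ← Nat.card_eq_fintype_card, ← mul_assoc, mul_div_cancel₀ _ hcard]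

open scoped Classical in
/-- Column orthogonality of the irreducible characters. -/
lemma sum_character_inv_mul_character {G ι : Type} [Group G] [Fintype G] [Fintype ι]
    (Irr : ι → FDRep ℂ G) (hsimple : ∀ i, Simple (Irr i))
    (hdistinct : ∀ i j, Nonempty (Irr i ≅ Irr j) → i = j)
    (hcomplete : ∀ V : FDRep ℂ G, Simple V → ∃ i, Nonempty (V ≅ Irr i)) (g x : G) :
    ∑ i, (Irr i).character x⁻¹ * (Irr i).character g =
      if IsConj g x then (Nat.card G : ℂ) / Nat.card {y : G // IsConj g y} else 0 := by
  have : Invertible (Nat.card G : ℂ) := invertibleOfNonzero (NeZero.ne _)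
  have hG : (Nat.card G : ℂ) ≠ 0 := NeZero.ne _
  have horth (i j : ι) : ∑ x, (Irr i).character x * (Irr j).character x⁻¹ =
      if i = j then (Nat.card G : ℂ) else 0 := by
    have := hsimple i
    have := hsimple j
    have h := FDRep.char_orthonormal (Irr i) (Irr j)
    rw [inv_mul_eq_iff_eq_mul₀ hG] at h
    have hiff : Nonempty (Irr i ≅ Irr j) ↔ i = j :=
      ⟨hdistinct i j, fun h ↦ h ▸ ⟨Iso.refl _⟩⟩
    rw [h]
    simp [hiff]
  let f : G → ℂ := fun x ↦ ∑ i, (Irr i).character x⁻¹ * (Irr i).character g -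
      if IsConj g x then (Nat.card G : ℂ) / Nat.card {y : G // IsConj g y} else 0
  suffices f = 0 from sub_eq_zero.1 (congrFun this x)
  refine eq_zero_of_sum_mul_character_eq_zero Irr hcomplete (fun x y ↦ ?_) fun j ↦ ?_
  · have hx : IsConj g (y * x * y⁻¹) ↔ IsConj g x := by
      have hxy : IsConj x (y * x * y⁻¹) := isConj_iff.2 ⟨y, rfl⟩
      exact ⟨fun h ↦ h.trans hxy.symm, fun h ↦ h.trans hxy⟩
    have hinv : (y * x * y⁻¹)⁻¹ = y * x⁻¹ * y⁻¹ := by group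
    simp only [f, hx, hinv, FDRep.char_conj]
  · have hsum : ∑ x, (∑ i, (Irr i).character x⁻¹ * (Irr i).character g) * (Irr j).character x =
        Nat.card G * (Irr j).character g := by
      calc _ = ∑ i, (∑ x, (Irr j).character x * (Irr i).character x⁻¹) *
            (Irr i).character g := by
            simp_rw [Finset.sum_mul]
            rw [Finset.sum_comm]
            exact Finset.sum_congr rfl fun i _ ↦ Finset.sum_congr rfl fun x _ ↦ by ring
        _ = _ := by simp [horth]
    simp only [f, sub_mul, Finset.sum_sub_distrib, hsum]
    rw [sum_isConj_div_card_mul fun x y ↦ FDRep.char_conj _ x y, sub_self]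

open scoped Classical in
/-- The multiplicities of irreducibles compute the inner product of restricted characters. -/
lemma sum_kappa_mul_kappa {G : Type} [Group G] (H : Subgroup G) [Fintype H]
    {ι : Type} [Fintype ι] (Irr : ι → FDRep ℂ H) (hsimple : ∀ t, Simple (Irr t))
    (hdistinct : ∀ t s, Nonempty (Irr t ≅ Irr s) → t = s)
    (hcomplete : ∀ W : FDRep ℂ H, Simple W → ∃ t, Nonempty (W ≅ Irr t)) (ρ σ : FDRep ℂ G) :
    ∑ t, kappa H (Irr t) ρ * kappa H (Irr t) σ =
      (Fintype.card H : ℂ)⁻¹ *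
        ∑ h : H, ρ.character (h : G) * σ.character (h : G)⁻¹ := by
  have hcol (h k : H) : ∑ t, (starRingEnd ℂ) ((Irr t).character h) *
      (starRingEnd ℂ) ((Irr t).character k) = if IsConj h k⁻¹ then
        (Nat.card H : ℂ) / Nat.card {y : H // IsConj h y} else 0 := by
    have hc := congrArg (starRingEnd ℂ)
      (sum_character_inv_mul_character Irr hsimple hdistinct hcomplete h k⁻¹)
    simp only [inv_inv, map_sum, map_mul, apply_ite (starRingEnd ℂ), map_div₀, map_natCast,
      map_zero] at hc
    simpa only [mul_comm] using hc
  have hinner (h : H) : ∑ k : H, (if IsConj h k⁻¹ then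
      (Nat.card H : ℂ) / Nat.card {y : H // IsConj h y} else 0) * σ.character (k : G) =
        Nat.card H * σ.character (h : G)⁻¹ := by
    rw [← sum_isConj_div_card_mul (F := fun k : H ↦ σ.character (k : G)⁻¹) (fun x y ↦ ?_)]
    · exact Fintype.sum_equiv (Equiv.inv H) _ _ fun k ↦ by simp
    · rw [← FDRep.char_conj σ (x : G)⁻¹ y]
      simp [mul_assoc]
  have hH : (Fintype.card H : ℂ) ≠ 0 := Nat.cast_ne_zero.2 Fintype.card_ne_zero
  calc _ = (Fintype.card H : ℂ)⁻¹ * (Fintype.card H : ℂ)⁻¹ * ∑ h : H, ρ.character (h : G) *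
        ∑ k : H, (∑ t, (starRingEnd ℂ) ((Irr t).character h) *
          (starRingEnd ℂ) ((Irr t).character k)) * σ.character (k : G) := by
        simp only [kappa, Finset.mul_sum, Finset.sum_mul]
        rw [Finset.sum_comm_cycle]
        simp only [Finset.sum_comm (s := (Finset.univ : Finset ι))]
        refine Finset.sum_congr rfl fun h _ ↦ Finset.sum_congr rfl fun k _ ↦
          Finset.sum_congr rfl fun t _ ↦ by ring
    _ = _ := by
        simp only [hcol, hinner]
        rw [Nat.card_eq_fintype_card, Finset.mul_sum, Finset.mul_sum]
        refine Finset.sum_congr rfl fun h _ ↦ ?_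
        field_simp

/-- For each conjugacy class `C` (the class of `g`), the function
`ψ_C(ρ) = |C|^{1/2}·χ^ρ(C)/dim ρ` is an eigenfunction of the operator `J`
with eigenvalue `|C ∩ H|/|C|`. -/
theorem stmt3 {G : Type} [Group G] [Fintype G] (H : Subgroup G) [Fintype H]
    {ιG ιH : Type} [Fintype ιG] [Fintype ιH]
    (IrrG : ιG → FDRep ℂ G) (IrrH : ιH → FDRep ℂ H)
    (hGsimple : ∀ i, Simple (IrrG i))
    (hGdistinct : ∀ i j, Nonempty (IrrG i ≅ IrrG j) → i = j)
    (hGcomplete : ∀ V : FDRep ℂ G, Simple V → ∃ i, Nonempty (V ≅ IrrG i))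
    (hHsimple : ∀ t, Simple (IrrH t))
    (hHdistinct : ∀ t s, Nonempty (IrrH t ≅ IrrH s) → t = s)
    (hHcomplete : ∀ W : FDRep ℂ H, Simple W → ∃ t, Nonempty (W ≅ IrrH t))
    (g : G) (i : ιG) :
    ∑ j : ιG,
      ((Fintype.card H : ℂ) / (Fintype.card G : ℂ) *
        ((finrank ℂ (IrrG j) : ℂ) / (finrank ℂ (IrrG i) : ℂ)) *
        ∑ t : ιH, kappa H (IrrH t) (IrrG i) * kappa H (IrrH t) (IrrG j)) *
      ((Real.sqrt (Nat.card {x : G // IsConj g x}) : ℂ) * (IrrG j).character g /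
        (finrank ℂ (IrrG j) : ℂ)) =
    ((Nat.card {x : G // IsConj g x ∧ x ∈ H} : ℂ) / (Nat.card {x : G // IsConj g x} : ℂ)) *
      ((Real.sqrt (Nat.card {x : G // IsConj g x}) : ℂ) * (IrrG i).character g /
        (finrank ℂ (IrrG i) : ℂ)) := by
  classical
  have hG : (Fintype.card G : ℂ) ≠ 0 := Nat.cast_ne_zero.2 Fintype.card_ne_zero
  have hdim (j : ιG) : (finrank ℂ (IrrG j) : ℂ) ≠ 0 := by
    intro h0
    have := hGsimple j
    have : Subsingleton (IrrG j) := finrank_zero_iff.1 (Nat.cast_eq_zero.1 h0)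
    have hchar (x : G) : (IrrG j).character x = 0 := by
      rw [FDRep.character, Subsingleton.elim ((IrrG j).ρ x) 0, map_zero]
    have hnorm := (FDRep.simple_iff_char_is_norm_one (IrrG j)).1 inferInstance
    simp [hchar, hG.symm] at hnorm
  have hH : (Fintype.card H : ℂ) ≠ 0 := Nat.cast_ne_zero.2 Fintype.card_ne_zero
  set s : ℂ := (Real.sqrt (Nat.card {x : G // IsConj g x}) : ℂ)
  have hcount : ∑ h : H, (if IsConj g (h : G) then (1 : ℂ) else 0) =
      Nat.card {x : G // IsConj g x ∧ x ∈ H} := by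
    rw [Finset.sum_boole, ← Fintype.card_subtype, ← Nat.card_eq_fintype_card]
    congr 1
    exact Nat.card_congr ((Equiv.subtypeSubtypeEquivSubtypeInter (· ∈ H) (IsConj g)).trans
      (Equiv.subtypeEquivRight fun x ↦ and_comm))
  have hterm (h : H) : (IrrG i).character (h : G) *
      (if IsConj g (h : G) then (Nat.card G : ℂ) / Nat.card {y : G // IsConj g y} else 0) =
      (if IsConj g (h : G) then 1 else 0) *
        ((IrrG i).character g * ((Nat.card G : ℂ) / Nat.card {y : G // IsConj g y})) := by
    split_ifs with hgh
    · obtain ⟨y, hy⟩ := isConj_iff.1 hgh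
      rw [← hy, FDRep.char_conj, one_mul]
    · simp
  calc _ = s / (Fintype.card G * finrank ℂ (IrrG i)) * ∑ h : H, (IrrG i).character (h : G) *
        ∑ j, (IrrG j).character (h : G)⁻¹ * (IrrG j).character g := by
        simp only [sum_kappa_mul_kappa H IrrH hHsimple hHdistinct hHcomplete, Finset.mul_sum,
          Finset.sum_mul]
        rw [Finset.sum_comm]
        refine Finset.sum_congr rfl fun h _ ↦ Finset.sum_congr rfl fun j _ ↦ ?_
        have := hdim i
        have := hdim j
        field_simp
    _ = _ := by
        simp only [sum_character_inv_mul_character IrrG hGsimple hGdistinct hGcomplete, hterm]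
        rw [← Finset.sum_mul, hcount, Nat.card_eq_fintype_card (α := G)]
        have := hdim i
        field_simp
end

section
/- Let G = GL(n,q) with n ≥ 2 and H = GL(n−1,q) embedded as the stabilizer of a vector (block-diagonally fixing the last coordinate). Then max over nonidentity g ∈ G of |g^G ∩ H|/|g^G| equals (1 − q^{−(n−1)})/(q²(1 − q^{−n})) if q > 2, and (1 − q^{−(n−2)})/(q²(1 − q^{−n})) if q = 2. -/
open Matrix

section FixedPointRatio

/-- Double counting of the pairs `(h, x)` with `h` conjugate to `g` and `h • x = x`. -/
theorem card_conj_stabilizer_mul_card {G X : Type*} [Group G] [Finite G] [Finite X] [MulAction G X]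
    [MulAction.IsPretransitive G X] (x₀ : X) (g : G) :
    Nat.card {h : G // IsConj g h ∧ h ∈ MulAction.stabilizer G x₀} * Nat.card X =
      Nat.card {h : G // IsConj g h} * Nat.card {x : X // g • x = x} := by
  have e : (Σ h : {h : G // IsConj g h}, {x : X // h.1 • x = x}) ≃
      (Σ x : X, {h : G // IsConj g h ∧ h ∈ MulAction.stabilizer G x}) :=
    { toFun := fun p => ⟨p.2.1, p.1.1, p.1.2, p.2.2⟩
      invFun := fun p => ⟨⟨p.2.1, p.2.2.1⟩, p.1, p.2.2.2⟩
      left_inv := fun _ => rfl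
      right_inv := fun _ => rfl }
  have h₁ : ∀ x : X, Nat.card {h : G // IsConj g h ∧ h ∈ MulAction.stabilizer G x} =
      Nat.card {h : G // IsConj g h ∧ h ∈ MulAction.stabilizer G x₀} := by
    intro x
    obtain ⟨k, rfl⟩ := MulAction.exists_smul_eq G x₀ x
    symm
    refine Nat.card_congr ((MulAut.conj k).toEquiv.subtypeEquiv fun h => ?_)
    have hc : IsConj g (k * h * k⁻¹) ↔ IsConj g h :=
      ⟨fun H => H.trans (isConj_iff.2 ⟨k⁻¹, by group⟩),
        fun H => H.trans (isConj_iff.2 ⟨k, rfl⟩)⟩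
    change _ ↔ IsConj g (k * h * k⁻¹) ∧ k * h * k⁻¹ ∈ MulAction.stabilizer G (k • x₀)
    rw [hc]
    simp [MulAction.mem_stabilizer_iff, mul_smul]
  have h₂ : ∀ h : {h : G // IsConj g h}, Nat.card {x : X // h.1 • x = x} =
      Nat.card {x : X // g • x = x} := by
    rintro ⟨h, hh⟩
    obtain ⟨k, rfl⟩ := isConj_iff.1 hh
    symm
    refine Nat.card_congr ((MulAction.toPerm k).subtypeEquiv fun x => ?_)
    simp [mul_smul]
  have := Fintype.ofFinite X
  have := Fintype.ofFinite {h : G // IsConj g h}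
  have h₃ := Nat.card_congr e
  rw [Nat.card_sigma, Nat.card_sigma, Finset.sum_congr rfl fun x _ => h₁ x,
    Finset.sum_congr rfl fun h _ => h₂ h, Finset.sum_const, Finset.sum_const, smul_eq_mul,
    smul_eq_mul, Finset.card_univ, Finset.card_univ, ← Nat.card_eq_fintype_card,
    ← Nat.card_eq_fintype_card] at h₃
  rw [mul_comm, h₃]

end FixedPointRatio

section Counting

variable {F : Type*} [Field F]

theorem card_linearFiber_mul [Fintype F] {M : Type*} [AddCommGroup M] [Module F M] [Finite M]
    (f : M →ₗ[F] F) (hf : f ≠ 0) (c : F) :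
    Nat.card {w : M // f w = c} * Fintype.card F = Nat.card M := by
  have hs : Function.Surjective f := LinearMap.surjective hf
  have h₁ : ∀ d : F, Nat.card {w : M // f w = d} = Nat.card {w : M // f w = c} := by
    intro d
    obtain ⟨a, ha⟩ := hs (c - d)
    refine Nat.card_congr ((Equiv.addRight a).subtypeEquiv fun w => ?_)
    simp only [Equiv.coe_addRight, map_add, ha]
    constructor
    · rintro rfl; ring
    · intro h; linear_combination h
  have h₂ := Nat.card_congr (Equiv.sigmaFiberEquiv f)
  rw [Nat.card_sigma] at h₂
  simp_rw [h₁] at h₂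
  simpa [mul_comm] using h₂

variable {n : ℕ}

/-- The space of fixed column vectors. -/
def fixedVectors (A : Matrix (Fin n) (Fin n) F) : Submodule F (Fin n → F) where
  carrier := {v | A *ᵥ v = v}
  add_mem' := fun {a b} ha hb => by simp_all [mulVec_add]
  zero_mem' := by simp
  smul_mem' := fun c v hv => by simp_all [mulVec_smul]

theorem mem_fixedVectors {A : Matrix (Fin n) (Fin n) F} {v : Fin n → F} :
    v ∈ fixedVectors A ↔ A *ᵥ v = v := Iff.rfl

theorem mem_fixedVectors_transpose {A : Matrix (Fin n) (Fin n) F} {v : Fin n → F} :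
    v ∈ fixedVectors Aᵀ ↔ v ᵥ* A = v := by
  rw [mem_fixedVectors, mulVec_transpose]

theorem fixedVectors_ne_top {A : Matrix (Fin n) (Fin n) F} (hA : A ≠ 1) : fixedVectors A ≠ ⊤ := by
  intro h
  refine hA (Matrix.ext_of_mulVec_single fun i => ?_)
  have : Pi.single i 1 ∈ fixedVectors A := h ▸ Submodule.mem_top
  rw [mem_fixedVectors.1 this, one_mulVec]

variable [Fintype F]

/-- Number of pairs `(v, w) ∈ K × L` with `w ⬝ᵥ v = 1`. -/
theorem card_dotProduct_eq_one_mul (K L : Submodule F (Fin n → F)) :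
    Nat.card {p : (Fin n → F) × (Fin n → F) // p.2 ⬝ᵥ p.1 = 1 ∧ p.1 ∈ K ∧ p.2 ∈ L} *
      Fintype.card F = Nat.card {v // v ∈ K ∧ ∃ w ∈ L, w ⬝ᵥ v ≠ 0} * Nat.card L := by
  have e : {p : (Fin n → F) × (Fin n → F) // p.2 ⬝ᵥ p.1 = 1 ∧ p.1 ∈ K ∧ p.2 ∈ L} ≃
      (Σ v : {v // v ∈ K ∧ ∃ w ∈ L, w ⬝ᵥ v ≠ 0}, {w : L // w.1 ⬝ᵥ v.1 = 1}) :=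
    { toFun := fun p => ⟨⟨p.1.1, p.2.2.1, p.1.2, p.2.2.2, by simp [p.2.1]⟩, ⟨p.1.2, p.2.2.2⟩, p.2.1⟩
      invFun := fun p => ⟨⟨p.1.1, p.2.1.1⟩, p.2.2, p.1.2.1, p.2.1.2⟩
      left_inv := fun _ => rfl
      right_inv := fun _ => rfl }
  have := Fintype.ofFinite {v // v ∈ K ∧ ∃ w ∈ L, w ⬝ᵥ v ≠ 0}
  rw [Nat.card_congr e, Nat.card_sigma, Finset.sum_mul]
  rw [Finset.sum_congr rfl (g := fun _ => Nat.card L)]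
  · simp
  rintro ⟨v, hv, w, hw, hwv⟩ -
  let f : L →ₗ[F] F :=
    { toFun := fun w => w.1 ⬝ᵥ v
      map_add' := fun a b => by simp [add_dotProduct]
      map_smul' := fun a b => by simp [smul_dotProduct] }
  refine card_linearFiber_mul f (fun h => hwv ?_) 1
  exact LinearMap.congr_fun h ⟨w, hw⟩

theorem natCard_submodule_eq (K : Submodule F (Fin n → F)) :
    Nat.card K = Fintype.card F ^ Module.finrank F K := by
  rw [Module.natCard_eq_pow_finrank (K := F), Nat.card_eq_fintype_card]

theorem natCard_submodule_le_of_ne_top (K : Submodule F (Fin n → F)) (hK : K ≠ ⊤) :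
    Nat.card K ≤ Fintype.card F ^ (n - 1) := by
  rw [natCard_submodule_eq]
  have := Submodule.finrank_lt (lt_top_iff_ne_top.2 hK).ne
  rw [Module.finrank_fin_fun] at this
  exact Nat.pow_le_pow_right Fintype.card_pos (by omega)

theorem card_nondegenerate_le (K L : Submodule F (Fin n → F)) :
    Nat.card {v // v ∈ K ∧ ∃ w ∈ L, w ⬝ᵥ v ≠ 0} ≤ Nat.card K - 1 := by
  have h : Nat.card {v // v ∈ K ∧ ∃ w ∈ L, w ⬝ᵥ v ≠ 0} ≤ ((K : Set (Fin n → F)) \ {0}).ncard := by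
    refine Set.ncard_le_ncard (s := {v | v ∈ K ∧ ∃ w ∈ L, w ⬝ᵥ v ≠ 0}) ?_ (Set.toFinite _)
    rintro v ⟨hv, w, hw, h⟩
    refine ⟨hv, ?_⟩
    rintro rfl
    simp at h
  rw [Set.ncard_sdiff_singleton_of_mem K.zero_mem] at h
  exact h

theorem card_nondegenerate_le_sub_two (K L : Submodule F (Fin n → F)) (u : Fin n → F) (hu : u ≠ 0)
    (huK : u ∈ K) (huL : ∀ w ∈ L, w ⬝ᵥ u = 0) :
    Nat.card {v // v ∈ K ∧ ∃ w ∈ L, w ⬝ᵥ v ≠ 0} ≤ Nat.card K - 2 := by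
  have h : Nat.card {v // v ∈ K ∧ ∃ w ∈ L, w ⬝ᵥ v ≠ 0} ≤
      ((K : Set (Fin n → F)) \ {0, u}).ncard := by
    refine Set.ncard_le_ncard (s := {v | v ∈ K ∧ ∃ w ∈ L, w ⬝ᵥ v ≠ 0}) ?_ (Set.toFinite _)
    rintro v ⟨hv, w, hw, h⟩
    refine ⟨hv, ?_⟩
    rintro (rfl | rfl)
    · simp at h
    · exact h (huL w hw)
  rw [Set.ncard_sdiff (by simp [Set.insert_subset_iff, huK]), Set.ncard_pair hu.symm] at h
  exact h

/-- `q` times the number of fixed points of `g` on pairs `(v, w)` with `w ⬝ᵥ v = 1`. -/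
noncomputable def fixedWeight (A : Matrix (Fin n) (Fin n) F) : ℕ :=
  Nat.card {v // v ∈ fixedVectors A ∧ ∃ w ∈ fixedVectors Aᵀ, w ⬝ᵥ v ≠ 0} *
    Nat.card (fixedVectors Aᵀ)

theorem fixedWeight_le {A : Matrix (Fin n) (Fin n) F} (hA : A ≠ 1) :
    fixedWeight A ≤ (Fintype.card F ^ (n - 1) - 1) * Fintype.card F ^ (n - 1) := by
  have hA' : Aᵀ ≠ 1 := by rwa [Ne, transpose_eq_one]
  have h₁ := natCard_submodule_le_of_ne_top _ (fixedVectors_ne_top hA)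
  have h₂ := natCard_submodule_le_of_ne_top _ (fixedVectors_ne_top hA')
  have h₃ := card_nondegenerate_le (fixedVectors A) (fixedVectors Aᵀ)
  exact Nat.mul_le_mul (h₃.trans (Nat.sub_le_sub_right h₁ 1)) h₂

theorem exists_mem_fixedVectors_of_card_eq_two (hn : 1 ≤ n) (hF : Fintype.card F = 2)
    {A : Matrix (Fin n) (Fin n) F} (hA : IsUnit A) (hA₁ : A ≠ 1)
    (hK : Module.finrank F (fixedVectors A) = n - 1) :
    ∃ u ≠ 0, u ∈ fixedVectors A ∧ ∀ w ∈ fixedVectors Aᵀ, w ⬝ᵥ u = 0 := by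
  obtain ⟨x, -, hx⟩ := SetLike.exists_of_lt (lt_top_iff_ne_top.2 (fixedVectors_ne_top hA₁))
  have hinj : Function.Injective A.mulVec := mulVec_injective_of_isUnit hA
  have hAx : A *ᵥ x ∉ fixedVectors A := fun h => hx (hinj h)
  have hi : (fixedVectors A).toAddSubgroup.index = 2 := by
    have h := (fixedVectors A).toAddSubgroup.card_mul_index
    have h' : Nat.card (fixedVectors A).toAddSubgroup = 2 ^ (n - 1) := by
      rw [← hF, ← hK, ← natCard_submodule_eq]; rfl
    rw [h', Nat.card_eq_fintype_card, Fintype.card_fun, hF, Fintype.card_fin] at h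
    obtain ⟨m, rfl⟩ := Nat.exists_eq_add_of_le' hn
    rw [Nat.add_sub_cancel, pow_succ] at h
    exact Nat.eq_of_mul_eq_mul_left (by positivity) h
  refine ⟨A *ᵥ x - x, sub_ne_zero.2 hx, ?_, fun w hw => ?_⟩
  · have h := AddSubgroup.add_mem_iff_of_index_two hi (a := A *ᵥ x) (b := -x)
    rw [← sub_eq_add_neg, neg_mem_iff] at h
    exact h.2 (iff_of_false hAx hx)
  · rw [dotProduct_sub, dotProduct_mulVec, mem_fixedVectors_transpose.1 hw, sub_self]

theorem fixedWeight_le_of_card_eq_two (hn : 2 ≤ n) (hF : Fintype.card F = 2)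
    {A : Matrix (Fin n) (Fin n) F} (hA : IsUnit A) (hA₁ : A ≠ 1) :
    fixedWeight A ≤ (2 ^ (n - 1) - 2) * 2 ^ (n - 1) := by
  have hA' : Aᵀ ≠ 1 := by rwa [Ne, transpose_eq_one]
  have h₁ := natCard_submodule_le_of_ne_top _ (fixedVectors_ne_top hA')
  rw [hF] at h₁
  have hlt := Submodule.finrank_lt (lt_top_iff_ne_top.2 (fixedVectors_ne_top hA₁)).ne
  rw [Module.finrank_fin_fun] at hlt
  refine Nat.mul_le_mul ?_ h₁
  by_cases hK : Module.finrank F (fixedVectors A) = n - 1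
  · obtain ⟨u, hu, huK, huL⟩ := exists_mem_fixedVectors_of_card_eq_two (by omega) hF hA hA₁ hK
    have h := card_nondegenerate_le_sub_two _ _ u hu huK huL
    rwa [natCard_submodule_eq, hK, hF] at h
  · have h := card_nondegenerate_le (fixedVectors A) (fixedVectors Aᵀ)
    rw [natCard_submodule_eq, hF] at h
    have h₂ : 2 ^ Module.finrank F (fixedVectors A) ≤ 2 ^ (n - 2) :=
      Nat.pow_le_pow_right two_pos (by omega)
    obtain ⟨m, rfl⟩ := Nat.exists_eq_add_of_le' hn
    have h₃ : 2 ^ (m + 2 - 1) = 2 * 2 ^ m := by rw [Nat.add_succ_sub_one, pow_succ']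
    rw [Nat.add_sub_cancel] at h₂
    omega

theorem natCard_apply_eq_zero (i : Fin n) :
    Nat.card {v : Fin n → F // v i = 0} = Fintype.card F ^ (n - 1) := by
  have h := card_linearFiber_mul (F := F) (LinearMap.proj (R := F) (φ := fun _ : Fin n => F) i)
    (fun h => by simpa using LinearMap.congr_fun h (Pi.single i 1)) 0
  rw [Nat.card_eq_fintype_card (α := Fin n → F), Fintype.card_fun, Fintype.card_fin] at h
  rw [← pow_sub_one_mul (Nat.ne_zero_of_lt i.2)] at h
  exact Nat.eq_of_mul_eq_mul_right Fintype.card_pos h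

theorem fixedWeight_one_add_single_diag (i : Fin n) {c : F} (hc : c ≠ 0) :
    fixedWeight (1 + Matrix.single i i c) =
      (Fintype.card F ^ (n - 1) - 1) * Fintype.card F ^ (n - 1) := by
  have hK : ∀ v : Fin n → F, v ∈ fixedVectors (1 + Matrix.single i i c) ↔ v i = 0 := by
    intro v
    rw [mem_fixedVectors, add_mulVec, one_mulVec, add_eq_left, single_mulVec]
    simp [funext_iff, Function.update_apply, hc]
  have hL : ∀ v : Fin n → F, v ∈ fixedVectors (1 + Matrix.single i i c)ᵀ ↔ v i = 0 := by
    intro v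
    rw [transpose_add, transpose_one, transpose_single, hK]
  rw [fixedWeight]
  congr 1
  · simp_rw [hK, hL]
    rw [← natCard_apply_eq_zero i]
    refine Eq.trans ?_
      (Set.ncard_sdiff_singleton_of_mem (s := {v : Fin n → F | v i = 0}) (a := 0) rfl)
    refine congrArg Set.ncard (Set.ext fun v => ?_)
    refine and_congr_right fun hv => ⟨?_, fun h => ?_⟩
    · rintro ⟨w, -, h⟩ rfl
      simp at h
    · obtain ⟨l, hl⟩ := Function.ne_iff.1 h
      refine ⟨Pi.single l 1, ?_, by simpa using hl⟩
      have : i ≠ l := by rintro rfl; exact hl hv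
      simp [this]
  · rw [← natCard_apply_eq_zero i]
    exact Nat.card_congr (Equiv.subtypeEquivRight hL)

theorem fixedWeight_transvection {i j : Fin n} (hij : i ≠ j) :
    fixedWeight (1 + Matrix.single i j (1 : F)) =
      (Fintype.card F ^ (n - 1) - Fintype.card F) * Fintype.card F ^ (n - 1) := by
  have hK : ∀ i j : Fin n, ∀ v : Fin n → F,
      v ∈ fixedVectors (1 + Matrix.single i j 1) ↔ v j = 0 := by
    intro i j v
    rw [mem_fixedVectors, add_mulVec, one_mulVec, add_eq_left, single_mulVec]
    simp [funext_iff, Function.update_apply]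
  have hL : ∀ v : Fin n → F, v ∈ fixedVectors (1 + Matrix.single i j 1)ᵀ ↔ v i = 0 := by
    intro v
    rw [transpose_add, transpose_one, transpose_single, hK]
  rw [fixedWeight]
  congr 1
  · simp_rw [hK, hL]
    have hr : (Set.range fun c : F => (Pi.single i c : Fin n → F)).ncard = Fintype.card F := by
      rw [← Set.image_univ]
      refine (Set.ncard_image_of_injective _ (Pi.single_injective (M := fun _ : Fin n => F) i)).trans ?_
      rw [Set.ncard_univ, Nat.card_eq_fintype_card]
    have hs : (Set.range fun c : F => (Pi.single i c : Fin n → F)) ⊆ {v | v j = 0} := by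
      rintro _ ⟨c, rfl⟩
      simp [hij.symm]
    rw [← natCard_apply_eq_zero j, ← hr]
    refine Eq.trans ?_ (Set.ncard_sdiff hs)
    refine congrArg Set.ncard (Set.ext fun v => ?_)
    refine and_congr_right fun hv => ⟨?_, fun h => ?_⟩
    · rintro ⟨w, hw, h⟩ ⟨c, rfl⟩
      simp [hw] at h
    · have : ∃ l, l ≠ i ∧ v l ≠ 0 := by
        by_contra! H
        refine h ⟨v i, funext fun l => ?_⟩
        rcases eq_or_ne l i with rfl | hl
        · simp
        · simp [hl, H l hl]
      obtain ⟨l, hl, hvl⟩ := this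
      exact ⟨Pi.single l 1, by simp [hl.symm], by simpa using hvl⟩
  · rw [← natCard_apply_eq_zero i]
    exact Nat.card_congr (Equiv.subtypeEquivRight hL)

end Counting

section DualPair

variable {F : Type*} [Field F] {n : ℕ}

/-- Pairs `(v, w)` of a column and a row vector with `w ⬝ᵥ v = 1`. -/
def DualPair (n : ℕ) (F : Type*) [Field F] : Type _ :=
  {p : (Fin n → F) × (Fin n → F) // p.2 ⬝ᵥ p.1 = 1}

instance [Finite F] : Finite (DualPair n F) := inferInstanceAs (Finite (Subtype _))

instance : SMul (GL (Fin n) F) (DualPair n F) where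
  smul g p := ⟨(g.1 *ᵥ p.1.1, p.1.2 ᵥ* g⁻¹.1), by
    rw [dotProduct_mulVec, vecMul_vecMul, Units.inv_mul, vecMul_one, p.2]⟩

theorem DualPair.smul_val (g : GL (Fin n) F) (p : DualPair n F) :
    (g • p).1 = (g.1 *ᵥ p.1.1, p.1.2 ᵥ* g⁻¹.1) := rfl

instance : MulAction (GL (Fin n) F) (DualPair n F) where
  one_smul p := Subtype.ext (by simp [DualPair.smul_val])
  mul_smul g h p := Subtype.ext (by
    rw [DualPair.smul_val, DualPair.smul_val, DualPair.smul_val, _root_.mul_inv_rev,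
      Units.val_mul, Units.val_mul, mulVec_mulVec, vecMul_vecMul])

theorem DualPair.smul_eq_iff {g : GL (Fin n) F} {p r : DualPair n F} :
    g • p = r ↔ g.1 *ᵥ p.1.1 = r.1.1 ∧ r.1.2 ᵥ* g.1 = p.1.2 := by
  have h : g • p = r ↔ g.1 *ᵥ p.1.1 = r.1.1 ∧ p.1.2 ᵥ* g⁻¹.1 = r.1.2 :=
    Subtype.ext_iff.trans Prod.ext_iff
  rw [h]
  refine and_congr_right fun _ => ⟨fun h => ?_, fun h => ?_⟩
  · rw [← h, vecMul_vecMul, Units.inv_mul, vecMul_one]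
  · rw [← h, vecMul_vecMul, Units.mul_inv, vecMul_one]

/-- The pair consisting of a standard basis vector and its dual. -/
def DualPair.std (i : Fin n) : DualPair n F := ⟨(Pi.single i 1, Pi.single i 1), by simp⟩

theorem exists_dotProduct_ne_zero_and {v w : Fin n → F} (hv : v ≠ 0) (hw : w ≠ 0) :
    ∃ u : Fin n → F, u ⬝ᵥ v ≠ 0 ∧ u ⬝ᵥ w ≠ 0 := by
  obtain ⟨a, ha⟩ := Function.ne_iff.1 hv
  obtain ⟨b, hb⟩ := Function.ne_iff.1 hw
  rw [Pi.zero_apply] at ha hb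
  by_cases h₁ : w a = 0
  · by_cases h₂ : v b = 0
    · exact ⟨Pi.single a 1 + Pi.single b 1, by simp [h₂, ha], by simp [h₁, hb]⟩
    · exact ⟨Pi.single b 1, by simpa using h₂, by simpa using hb⟩
  · exact ⟨Pi.single a 1, by simpa using ha, by simpa using h₁⟩

theorem det_one_add_vecMulVec (v w : Fin n → F) : (1 + vecMulVec v w).det = 1 + w ⬝ᵥ v := by
  rw [vecMulVec_eq Unit, det_one_add_replicateCol_mul_replicateRow]

theorem exists_GL_mulVec_eq {v w : Fin n → F} (hv : v ≠ 0) (hw : w ≠ 0) :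
    ∃ g : GL (Fin n) F, g.1 *ᵥ v = w := by
  obtain ⟨u, huv, huw⟩ := exists_dotProduct_ne_zero_and hv hw
  let A : Matrix (Fin n) (Fin n) F := 1 + vecMulVec (w - v) ((u ⬝ᵥ v)⁻¹ • u)
  have hA : A.det ≠ 0 := by
    have h : 1 + (u ⬝ᵥ v)⁻¹ * (u ⬝ᵥ w - u ⬝ᵥ v) = (u ⬝ᵥ v)⁻¹ * (u ⬝ᵥ w) := by
      field_simp
      ring
    rw [det_one_add_vecMulVec, smul_dotProduct, dotProduct_sub, smul_eq_mul, h]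
    exact mul_ne_zero (inv_ne_zero huv) huw
  refine ⟨GeneralLinearGroup.mkOfDetNeZero A hA, ?_⟩
  change A *ᵥ v = w
  rw [add_mulVec, one_mulVec, vecMulVec_mulVec, smul_dotProduct, smul_eq_mul, inv_mul_cancel₀ huv]
  simp

theorem DualPair.exists_smul_std_eq (i : Fin n) (p : DualPair n F) :
    ∃ g : GL (Fin n) F, g • DualPair.std i = p := by
  have hp : p.1.2 ⬝ᵥ p.1.1 = 1 := p.2
  have hv : p.1.1 ≠ 0 := by intro h; simp [h] at hp
  obtain ⟨g, hg⟩ := exists_GL_mulVec_eq (v := Pi.single i (1 : F)) (by simp) hv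
  set u : Fin n → F := p.1.2 ᵥ* g.1 - Pi.single i 1 with hu
  have hu₀ : u ⬝ᵥ Pi.single i 1 = 0 := by
    rw [hu, sub_dotProduct, ← dotProduct_mulVec, hg, hp]
    simp
  have hsq : vecMulVec (Pi.single i 1) u * vecMulVec (Pi.single i 1) u = 0 := by
    rw [vecMulVec_mul_vecMulVec, hu₀]
    simp
  let k : GL (Fin n) F :=
    ⟨1 - vecMulVec (Pi.single i 1) u, 1 + vecMulVec (Pi.single i 1) u,
      by simp [sub_mul, mul_add, hsq], by simp [add_mul, mul_sub, hsq]⟩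
  refine ⟨g * k, DualPair.smul_eq_iff.2 ⟨?_, ?_⟩⟩
  · change (g.1 * (1 - vecMulVec (Pi.single i 1) u)) *ᵥ Pi.single i 1 = _
    rw [← mulVec_mulVec, sub_mulVec, vecMulVec_mulVec, hu₀]
    rw [MulOpposite.op_zero, zero_smul, sub_zero, one_mulVec]
    exact hg
  · change p.1.2 ᵥ* (g.1 * (1 - vecMulVec (Pi.single i 1) u)) = Pi.single i 1
    rw [← vecMul_vecMul, ← sub_add_cancel (p.1.2 ᵥ* g.1) (Pi.single i 1), ← hu, vecMul_sub,
      vecMul_one, vecMul_vecMulVec, add_dotProduct, hu₀]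
    simp

instance : MulAction.IsPretransitive (GL (Fin n) F) (DualPair n F) := by
  rcases n with _ | n
  · exact ⟨fun p => by have h := p.2; simp at h⟩
  · exact (MulAction.isPretransitive_iff_base (DualPair.std 0)).2 (DualPair.exists_smul_std_eq 0)

theorem DualPair.mem_stabilizer_std {i : Fin n} {g : GL (Fin n) F} :
    g ∈ MulAction.stabilizer (GL (Fin n) F) (DualPair.std i : DualPair n F) ↔
      (∀ a, g.1 a i = if a = i then 1 else 0) ∧ ∀ b, g.1 i b = if b = i then 1 else 0 := by
  rw [MulAction.mem_stabilizer_iff, DualPair.smul_eq_iff]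
  simp [DualPair.std, funext_iff, Pi.single_apply]

variable [Fintype F]

theorem DualPair.natCard_mul :
    Nat.card (DualPair n F) * Fintype.card F =
      (Fintype.card F ^ n - 1) * Fintype.card F ^ n := by
  have h := card_dotProduct_eq_one_mul (F := F) (n := n) ⊤ ⊤
  have h₁ : Nat.card (⊤ : Submodule F (Fin n → F)) = Fintype.card F ^ n := by
    rw [natCard_submodule_eq, finrank_top, Module.finrank_fin_fun]
  have h₂ : Nat.card {v : Fin n → F // v ∈ (⊤ : Submodule F (Fin n → F)) ∧
      ∃ w ∈ (⊤ : Submodule F (Fin n → F)), w ⬝ᵥ v ≠ 0} = Fintype.card F ^ n - 1 := by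
    rw [← h₁]
    refine Eq.trans ?_ (Set.ncard_sdiff_singleton_of_mem
      (s := ((⊤ : Submodule F (Fin n → F)) : Set (Fin n → F))) (Submodule.zero_mem _))
    refine congrArg Set.ncard (Set.ext fun v => and_congr_right fun _ => ⟨?_, fun h => ?_⟩)
    · rintro ⟨w, -, h⟩ rfl
      simp at h
    · obtain ⟨w, hw, -⟩ := exists_dotProduct_ne_zero_and h h
      exact ⟨w, trivial, hw⟩
  rw [h₁, h₂] at h
  rw [← h]
  congr 1
  exact Nat.card_congr (Equiv.subtypeEquivRight fun p => by simp)

theorem DualPair.natCard_fixed_mul (g : GL (Fin n) F) :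
    Nat.card {p : DualPair n F // g • p = p} * Fintype.card F = fixedWeight g.1 := by
  rw [fixedWeight, ← card_dotProduct_eq_one_mul]
  congr 1
  have h : ∀ p : DualPair n F, g • p = p ↔
      p.1.1 ∈ fixedVectors g.1 ∧ p.1.2 ∈ fixedVectors g.1ᵀ := fun p => by
    rw [DualPair.smul_eq_iff, mem_fixedVectors, mem_fixedVectors_transpose]
  exact Nat.card_congr ((Equiv.subtypeEquivRight h).trans
    (Equiv.subtypeSubtypeEquivSubtypeInter (fun p : (Fin n → F) × (Fin n → F) => p.2 ⬝ᵥ p.1 = 1)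
      fun p => p.1 ∈ fixedVectors g.1 ∧ p.2 ∈ fixedVectors g.1ᵀ))

theorem card_conj_stabilizer_div (i : Fin n) (g : GL (Fin n) F) :
    (Nat.card {h : GL (Fin n) F // IsConj g h ∧
        h ∈ MulAction.stabilizer (GL (Fin n) F) (DualPair.std i : DualPair n F)} : ℝ) /
      Nat.card {h : GL (Fin n) F // IsConj g h} =
    fixedWeight g.1 / (((Fintype.card F ^ n - 1) * Fintype.card F ^ n : ℕ) : ℝ) := by
  have h := card_conj_stabilizer_mul_card (DualPair.std i : DualPair n F) g
  have : Nonempty {h : GL (Fin n) F // IsConj g h} := ⟨g, IsConj.refl g⟩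
  have : Nonempty (DualPair n F) := ⟨DualPair.std i⟩
  have hF : 0 < Fintype.card F := Fintype.card_pos
  have h₁ : 0 < Nat.card {h : GL (Fin n) F // IsConj g h} := Nat.card_pos
  have h₂ : 0 < Nat.card (DualPair n F) := Nat.card_pos
  rw [← DualPair.natCard_fixed_mul, ← DualPair.natCard_mul, div_eq_div_iff
    (by positivity) (by positivity)]
  norm_cast
  rw [← mul_assoc, h]
  ring

end DualPair

/-- For `G = GL(n,q)` (`n ≥ 2`) and `H = GL(n−1,q)` embedded block-diagonally (fixing the
last coordinate), the maximum over nonidentity `g` of `|g^G ∩ H|/|g^G|` is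
`(1 − q^{−(n−1)})/(q²(1 − q^{−n}))` for `q > 2` and `(1 − q^{−(n−2)})/(q²(1 − q^{−n}))`
for `q = 2`. -/
theorem stmt9 {F : Type*} [Field F] [Fintype F] [DecidableEq F]
    (n : ℕ) (hn : 2 ≤ n) (i0 : Fin n) (hi0 : (i0 : ℕ) = n - 1)
    (H : Subgroup (GL (Fin n) F))
    (hH : ∀ g : GL (Fin n) F, g ∈ H ↔
      (∀ i : Fin n, (g : Matrix (Fin n) (Fin n) F) i i0 = if i = i0 then 1 else 0) ∧
      (∀ j : Fin n, (g : Matrix (Fin n) (Fin n) F) i0 j = if j = i0 then 1 else 0)) :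
    IsGreatest
      {x : ℝ | ∃ g : GL (Fin n) F, g ≠ 1 ∧
        x = (Nat.card {h : GL (Fin n) F // IsConj g h ∧ h ∈ H} : ℝ) /
          (Nat.card {h : GL (Fin n) F // IsConj g h} : ℝ)}
      (if Fintype.card F = 2 then
        (1 - ((Fintype.card F : ℝ))⁻¹ ^ (n - 2)) /
          ((Fintype.card F : ℝ) ^ 2 * (1 - ((Fintype.card F : ℝ))⁻¹ ^ n))
      else
        (1 - ((Fintype.card F : ℝ))⁻¹ ^ (n - 1)) /
          ((Fintype.card F : ℝ) ^ 2 * (1 - ((Fintype.card F : ℝ))⁻¹ ^ n))) := by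
  set q := Fintype.card F with hq
  have hH' : H = MulAction.stabilizer (GL (Fin n) F) (DualPair.std i0 : DualPair n F) :=
    Subgroup.ext fun g => (hH g).trans DualPair.mem_stabilizer_std.symm
  subst hH'
  simp_rw [card_conj_stabilizer_div]
  rw [← hq]
  have hq₂ : 2 ≤ q := Fintype.one_lt_card
  have hqR : (2 : ℝ) ≤ q := by exact_mod_cast hq₂
  have hpow : (1 : ℝ) < (q : ℝ) ^ n := one_lt_pow₀ (by linarith) (by omega)
  have hpos : (0 : ℝ) < (((q ^ n - 1) * q ^ n : ℕ) : ℝ) := by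
    rw [Nat.cast_mul, Nat.cast_pred (by positivity), Nat.cast_pow]
    exact mul_pos (by linarith) (by positivity)
  have hval : (if q = 2 then
        (1 - ((q : ℝ))⁻¹ ^ (n - 2)) / ((q : ℝ) ^ 2 * (1 - ((q : ℝ))⁻¹ ^ n))
      else (1 - ((q : ℝ))⁻¹ ^ (n - 1)) / ((q : ℝ) ^ 2 * (1 - ((q : ℝ))⁻¹ ^ n))) =
      (((if q = 2 then q ^ (n - 1) - q else q ^ (n - 1) - 1) * q ^ (n - 1) : ℕ) : ℝ) /
        (((q ^ n - 1) * q ^ n : ℕ) : ℝ) := by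
    have h₀ : (q : ℝ) ≠ 0 := by positivity
    have h₁ : (q : ℝ) ^ n - 1 ≠ 0 := by linarith
    have h₂ : 1 - ((q : ℝ))⁻¹ ^ n = ((q : ℝ) ^ n - 1) / (q : ℝ) ^ n := by
      rw [inv_pow, sub_div, div_self (by positivity), one_div]
    rw [h₂]
    obtain ⟨m, rfl⟩ := Nat.exists_eq_add_of_le' hn
    rw [Nat.add_sub_cancel, show m + 2 - 1 = m + 1 from rfl, Nat.cast_mul, Nat.cast_mul,
      Nat.cast_pred (by positivity), Nat.cast_pow, Nat.cast_pow]
    split_ifs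
    · rw [Nat.cast_sub (Nat.le_self_pow (by omega) q), Nat.cast_pow, inv_pow]
      field_simp
      ring
    · rw [Nat.cast_pred (by positivity), Nat.cast_pow, inv_pow]
      field_simp
      ring
  rw [hval]
  constructor
  · have hcard : ∃ g : GL (Fin n) F, g ≠ 1 ∧ fixedWeight g.1 =
        (if q = 2 then q ^ (n - 1) - q else q ^ (n - 1) - 1) * q ^ (n - 1) := by
      split_ifs with h2
      · obtain ⟨j, hj⟩ : ∃ j : Fin n, i0 ≠ j := ⟨⟨0, by omega⟩, by
          intro h
          rw [h] at hi0
          simp at hi0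
          omega⟩
        let g : GL (Fin n) F := GeneralLinearGroup.mkOfDetNeZero (1 + Matrix.single i0 j 1)
          (by rw [← Matrix.transvection, det_transvection_of_ne i0 j hj]; exact one_ne_zero)
        refine ⟨g, fun h => ?_, fixedWeight_transvection hj⟩
        have h' : 1 + Matrix.single i0 j (1 : F) = 1 := congrArg Units.val h
        have h'' := congrFun₂ (add_eq_left.1 h') i0 j
        rw [Matrix.single_apply_same] at h''
        exact one_ne_zero h''
      · obtain ⟨c, hc₀, hc₁⟩ : ∃ c : F, c ≠ 0 ∧ c ≠ -1 := by
          by_contra! H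
          have hle : q ≤ ({0, -1} : Finset F).card :=
            Finset.card_le_card fun c _ => by
              rw [Finset.mem_insert, Finset.mem_singleton]
              exact or_iff_not_imp_left.2 (H c)
          have := Finset.card_le_two (a := (0 : F)) (b := -1)
          omega
        let g : GL (Fin n) F := GeneralLinearGroup.mkOfDetNeZero (1 + Matrix.single i0 i0 c) (by
          have h : Matrix.single i0 i0 c = vecMulVec (Pi.single i0 c) (Pi.single i0 1) := by
            ext a b
            rw [vecMulVec_apply, Matrix.single_apply, Pi.single_apply, Pi.single_apply]
            grind
          rw [h, det_one_add_vecMulVec, single_dotProduct, Pi.single_eq_same, one_mul]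
          exact fun h => hc₁ (eq_neg_of_add_eq_zero_right h))
        refine ⟨g, fun h => ?_, fixedWeight_one_add_single_diag i0 hc₀⟩
        have h' : 1 + Matrix.single i0 i0 c = 1 := congrArg Units.val h
        exact hc₀ (by simpa using congrFun₂ (add_eq_left.1 h') i0 i0)
    obtain ⟨g, hg, h⟩ := hcard
    exact ⟨g, hg, by rw [h]⟩
  · rintro _ ⟨g, hg, rfl⟩
    have hg' : g.1 ≠ 1 := fun h => hg (Units.ext h)
    refine div_le_div_of_nonneg_right (Nat.cast_le.2 ?_) hpos.le
    split_ifs with h2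
    · rw [h2]
      exact fixedWeight_le_of_card_eq_two hn h2 g.isUnit hg'
    · exact fixedWeight_le hg'
end

section
/- In GL(n,q) with n ≥ 2 and H = GL(n−1,q) embedded as above, if g ∈ GL(n,q) has a conjugate lying in H (equivalently the partition λ_{z−1}(g) attached to the polynomial z−1 has at least one part equal to 1), then g^G ∩ H is a single H-conjugacy class, and |g^G ∩ H|/|g^G| = (|GL(n−1,q)|/|GL(n,q)|)·(1 − q^{−m₁(λ_{z−1}(g))})·q^{2λ'_{z−1,1}(g) − 1}, where m₁ is the number of parts of size 1 and λ'₁ is the total number of parts of λ_{z−1}(g). -/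
open Matrix

theorem Nat.card_eq_card_mul_of_card_fiber_eq {α β : Type*} [Finite α] [Finite β] (f : α → β) (k : ℕ)
    (hf : ∀ b, Nat.card {a // f a = b} = k) : Nat.card α = Nat.card β * k := by
  classical
  have := Fintype.ofFinite β
  rw [← Nat.card_congr (Equiv.sigmaFiberEquiv f), Nat.card_sigma]
  simp [hf]

theorem card_conj_eq_card_isConj_mul_card_centralizer {G : Type*} [Group G] [Finite G]
    (Q : G → Prop) (g : G) :
    Nat.card {t : G // Q (t⁻¹ * g * t)} =
      Nat.card {h : G // IsConj g h ∧ Q h} * Nat.card (Subgroup.centralizer {g}) := by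
  refine Nat.card_eq_card_mul_of_card_fiber_eq
    (fun t => ⟨t.1⁻¹ * g * t.1, isConj_iff.2 ⟨t.1⁻¹, by simp⟩, t.2⟩) _ ?_
  rintro ⟨h, hc, hQ⟩
  obtain ⟨s, hs⟩ := isConj_iff.1 hc
  exact Nat.card_congr
    { toFun := fun t => ⟨t.1.1 * s, by
        have ht : t.1.1⁻¹ * g * t.1.1 = h := congrArg Subtype.val t.2
        have hts := congrArg (fun x => t.1.1 * x * s) (hs.trans ht.symm)
        exact Subgroup.mem_centralizer_singleton_iff.2 (by simpa [mul_assoc] using hts)⟩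
      invFun := fun z =>
        have hz : (z.1 * s⁻¹)⁻¹ * g * (z.1 * s⁻¹) = h := by
          have := Subgroup.mem_centralizer_singleton_iff.1 z.2
          rw [← hs, mul_assoc, ← mul_assoc g, ← this]
          group
        ⟨⟨z.1 * s⁻¹, hz.symm ▸ hQ⟩, Subtype.ext hz⟩
      left_inv := fun t => by simp
      right_inv := fun z => by simp }

namespace Matrix

variable {F ι : Type*} [Field F] [Fintype ι] [DecidableEq ι]

/-- The vector-covector pairs of pairing `1` that are fixed by the matrix `A`. -/
def fixedPairs (A : Matrix ι ι F) : Set ((ι → F) × (ι → F)) :=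
  {p | A *ᵥ p.1 = p.1 ∧ p.2 ᵥ* A = p.2 ∧ p.2 ⬝ᵥ p.1 = 1}

/-- The centralizer of `A` acts transitively on the pairs fixed by `A`. -/
theorem exists_commute_of_mem_fixedPairs (A : Matrix ι ι F) {v φ w ψ : ι → F}
    (h₁ : (v, φ) ∈ fixedPairs A) (h₂ : (w, ψ) ∈ fixedPairs A) :
    ∃ c : GL ι F, (c : Matrix ι ι F) * A = A * c ∧ (c : Matrix ι ι F) *ᵥ v = w ∧
      ψ ᵥ* (c : Matrix ι ι F) = φ := by
  obtain ⟨hv, hφ, hφv⟩ := h₁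
  obtain ⟨hw, hψ, hψw⟩ := h₂
  simp only at hv hφ hφv hw hψ hψw
  obtain ⟨b, hb, hψb, hφb⟩ : ∃ b, A *ᵥ b = b ∧ ψ ⬝ᵥ b = 1 ∧ φ ⬝ᵥ b ≠ 0 := by
    by_cases h : φ ⬝ᵥ w = 0
    · by_cases h' : ψ ⬝ᵥ v = 0
      · exact ⟨v + w, by rw [mulVec_add, hv, hw], by simp [h', hψw], by simp [h, hφv]⟩
      · exact ⟨(ψ ⬝ᵥ v)⁻¹ • v, by rw [mulVec_smul, hv], by simp [h'], by simp [h', hφv]⟩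
    · exact ⟨w, hw, hψw, h⟩
  set β : ι → F := (ψ ⬝ᵥ v) • φ - ψ with hβ
  have hβA : β ᵥ* A = β := by rw [hβ, sub_vecMul, smul_vecMul, hφ, hψ]
  set C : Matrix ι ι F := 1 + vecMulVec (w - v) φ + vecMulVec b β with hC
  have hCx (x : ι → F) : C *ᵥ x = x + (φ ⬝ᵥ x) • (w - v) + (β ⬝ᵥ x) • b := by
    simp [hC, add_mulVec, vecMulVec_mulVec]
  have hψC : ψ ᵥ* C = φ := by
    have : ψ ᵥ* C = ψ + (ψ ⬝ᵥ (w - v)) • φ + (ψ ⬝ᵥ b) • β := by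
      simp [hC, vecMul_add, vecMul_vecMulVec]
    rw [this, dotProduct_sub, hψw, hψb, hβ]
    module
  have hunit : IsUnit C := by
    rw [← mulVec_injective_iff_isUnit, ← coe_mulVecLin, ← LinearMap.ker_eq_bot,
      LinearMap.ker_eq_bot']
    intro x hx
    rw [mulVecLin_apply] at hx
    have hφx : φ ⬝ᵥ x = 0 := by rw [← hψC, ← dotProduct_mulVec, hx, dotProduct_zero]
    have hβx : β ⬝ᵥ x = -(ψ ⬝ᵥ x) := by simp [hβ, sub_dotProduct, hφx]
    rw [hCx, hφx, hβx] at hx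
    have hxb : x = (ψ ⬝ᵥ x) • b := by
      simpa [neg_smul, ← sub_eq_add_neg, sub_eq_zero] using hx
    rw [hxb, dotProduct_smul, smul_eq_mul] at hφx
    have : ψ ⬝ᵥ x = 0 := (mul_eq_zero.mp hφx).resolve_right hφb
    rw [hxb, this, zero_smul]
  refine ⟨hunit.unit, ?_, ?_, hψC⟩
  · simp only [IsUnit.unit_spec, hC]
    rw [add_mul, add_mul, mul_add, mul_add, vecMulVec_mul, vecMulVec_mul, mul_vecMulVec,
      mul_vecMulVec, hφ, hβA, hb, mulVec_sub, hv, hw, one_mul, mul_one]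
  · have hβv : β ⬝ᵥ v = 0 := by simp [hβ, sub_dotProduct, hφv]
    rw [IsUnit.unit_spec, hCx, hφv, hβv]
    simp

theorem finrank_ker_vecMulLinear (N : Matrix ι ι F) :
    Module.finrank F (LinearMap.ker N.vecMulLinear) =
      Module.finrank F (LinearMap.ker N.toLin') := by
  have h₁ := LinearMap.finrank_range_add_finrank_ker N.vecMulLinear
  have h₂ := LinearMap.finrank_range_add_finrank_ker N.toLin'
  have h₃ := N.rank_transpose
  rw [← mulVecLin_transpose] at h₁
  rw [rank, rank, ← toLin'_apply' N] at h₃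
  rw [← mulVecLin_transpose]
  omega

theorem _root_.LinearMap.finrank_ker_inf_range {V : Type*} [AddCommGroup V] [Module F V] [FiniteDimensional F V]
    (N : V →ₗ[F] V) :
    Module.finrank F (LinearMap.ker N ⊓ LinearMap.range N : Submodule F V) +
      Module.finrank F (LinearMap.ker N) = Module.finrank F (LinearMap.ker (N ∘ₗ N)) := by
  have h := LinearMap.finrank_range_add_finrank_ker (N.domRestrict (LinearMap.ker (N ∘ₗ N)))
  have hle : LinearMap.ker N ≤ LinearMap.ker (N ∘ₗ N) := LinearMap.ker_le_ker_comp N N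
  rw [LinearMap.range_domRestrict, LinearMap.ker_comp, Submodule.map_comap_eq, inf_comm,
    LinearMap.ker_domRestrict] at h
  rw [LinearMap.ker_comp] at hle ⊢
  rw [← h, (Submodule.comapSubtypeEquivOfLe hle).finrank_eq]

/-- A vector outside the column space of `N` pairs to `1` with some covector killed by `N`. -/
theorem exists_vecMul_eq_zero_dotProduct_eq_one (N : Matrix ι ι F) {v : ι → F}
    (hv : v ∉ LinearMap.range N.toLin') : ∃ φ : ι → F, φ ᵥ* N = 0 ∧ φ ⬝ᵥ v = 1 := by
  obtain ⟨f, hf, hle⟩ := Submodule.exists_le_ker_of_notMem hv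
  have hfd (x : ι → F) : (dotProductEquiv F ι).symm f ⬝ᵥ x = f x := by
    conv_rhs => rw [← (dotProductEquiv F ι).apply_symm_apply f]
    rfl
  refine ⟨(f v)⁻¹ • (dotProductEquiv F ι).symm f, ?_, ?_⟩
  · rw [smul_vecMul]
    suffices (dotProductEquiv F ι).symm f ᵥ* N = 0 by rw [this, smul_zero]
    refine dotProduct_eq_zero _ fun x => ?_
    rw [← dotProduct_mulVec, hfd]
    exact hle ⟨x, rfl⟩
  · rw [smul_dotProduct, hfd, smul_eq_mul, inv_mul_cancel₀ hf]

theorem card_vecMul_eq_zero_dotProduct_eq_one (N : Matrix ι ι F) {v : ι → F}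
    (hv : v ∉ LinearMap.range N.toLin') :
    Nat.card {φ : ι → F // φ ᵥ* N = 0 ∧ φ ⬝ᵥ v = 1} =
      Nat.card F ^ (Module.finrank F (LinearMap.ker N.toLin') - 1) := by
  obtain ⟨φ₀, hφ₀, hφ₀v⟩ := exists_vecMul_eq_zero_dotProduct_eq_one N hv
  let ev : LinearMap.ker N.vecMulLinear →ₗ[F] F :=
    ((dotProductBilin F F).flip v).domRestrict _
  have hev (x : LinearMap.ker N.vecMulLinear) : ev x = (x : ι → F) ⬝ᵥ v := rfl
  have hsurj : LinearMap.range ev = ⊤ := by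
    rw [LinearMap.range_eq_top]
    intro a
    exact ⟨a • ⟨φ₀, hφ₀⟩, by rw [map_smul, hev]; simp [hφ₀v]⟩
  have hrank := LinearMap.finrank_range_add_finrank_ker ev
  rw [hsurj, finrank_top, Module.finrank_self, finrank_ker_vecMulLinear] at hrank
  rw [show Module.finrank F (LinearMap.ker N.toLin') - 1 = Module.finrank F (LinearMap.ker ev) by
    omega]
  refine Eq.trans (Nat.card_congr ?_) (Module.natCard_eq_pow_finrank (V := LinearMap.ker ev))
  refine
    { toFun := fun φ => ⟨⟨φ.1 - φ₀, ?_⟩, ?_⟩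
      invFun := fun x => ⟨x.1.1 + φ₀, ?_, ?_⟩
      left_inv := fun φ => by simp
      right_inv := fun x => by simp }
  · rw [LinearMap.mem_ker, vecMulLinear_apply, sub_vecMul, φ.2.1, hφ₀, sub_zero]
  · rw [LinearMap.mem_ker, hev, sub_dotProduct, φ.2.2, hφ₀v, sub_self]
  · have := x.1.2
    rw [LinearMap.mem_ker, vecMulLinear_apply] at this
    rw [add_vecMul, this, hφ₀, add_zero]
  · have := x.2
    rw [LinearMap.mem_ker, hev] at this
    rw [add_dotProduct, this, hφ₀v, zero_add]

variable [Finite F]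

theorem card_fixedPairs (A : Matrix ι ι F) :
    Nat.card (fixedPairs A) =
      (Nat.card F ^ Module.finrank F (LinearMap.ker (A - 1).toLin') -
        Nat.card F ^ Module.finrank F
          (LinearMap.ker (A - 1).toLin' ⊓ LinearMap.range (A - 1).toLin' : Submodule F (ι → F))) *
      Nat.card F ^ (Module.finrank F (LinearMap.ker (A - 1).toLin') - 1) := by
  set N := A - 1 with hN
  have hAv (v : ι → F) : A *ᵥ v = v ↔ v ∈ LinearMap.ker N.toLin' := by
    rw [LinearMap.mem_ker, toLin'_apply, hN, sub_mulVec, one_mulVec, sub_eq_zero]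
  have hφA (φ : ι → F) : φ ᵥ* A = φ ↔ φ ᵥ* N = 0 := by
    rw [hN, vecMul_sub, vecMul_one, sub_eq_zero]
  set K := LinearMap.ker N.toLin'
  set R := LinearMap.range N.toLin'
  have hnot {v φ : ι → F} (hφ : φ ᵥ* N = 0) (hv : φ ⬝ᵥ v = 1) : v ∉ R := by
    rintro ⟨u, rfl⟩
    rw [toLin'_apply, dotProduct_mulVec, hφ, zero_dotProduct] at hv
    exact zero_ne_one hv
  let f : fixedPairs A → ((K : Set (ι → F)) \ (K ⊓ R : Submodule F (ι → F)) : Set (ι → F)) :=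
    fun p => ⟨p.1.1, (hAv _).1 p.2.1, fun h => hnot ((hφA _).1 p.2.2.1) p.2.2.2 h.2⟩
  rw [Nat.card_eq_card_mul_of_card_fiber_eq f
    (Nat.card F ^ (Module.finrank F (LinearMap.ker N.toLin') - 1))]
  · congr 1
    rw [Nat.card_coe_set_eq, Set.ncard_sdiff (fun _ h => h.1), ← Nat.card_coe_set_eq,
      ← Nat.card_coe_set_eq, ← Module.natCard_eq_pow_finrank (K := F),
      ← Module.natCard_eq_pow_finrank (K := F)]
    rfl
  · rintro ⟨v, hvK, hvR⟩
    rw [← card_vecMul_eq_zero_dotProduct_eq_one N (v := v) fun h => hvR ⟨hvK, h⟩]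
    refine Nat.card_congr
      { toFun := fun p => ⟨p.1.1.2, (hφA _).1 p.1.2.2.1, ?_⟩
        invFun := fun φ => ⟨⟨(v, φ.1), (hAv _).2 hvK, (hφA _).2 φ.2.1, φ.2.2⟩, rfl⟩
        left_inv := ?_
        right_inv := fun φ => rfl }
    · have h : p.1.1.1 = v := congrArg Subtype.val p.2
      have hp := p.1.2.2.2
      rwa [h] at hp
    · rintro ⟨⟨⟨x, φ⟩, hp⟩, h⟩
      have h' : x = v := congrArg Subtype.val h
      subst h'
      rfl

theorem cast_card_fixedPairs (A : Matrix ι ι F)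
    (h : Module.finrank F (LinearMap.ker ((A - 1) * (A - 1)).toLin') <
      2 * Module.finrank F (LinearMap.ker (A - 1).toLin')) :
    (Nat.card (fixedPairs A) : ℝ) =
      (1 - (Nat.card F : ℝ)⁻¹ ^ (2 * Module.finrank F (LinearMap.ker (A - 1).toLin') -
        Module.finrank F (LinearMap.ker ((A - 1) * (A - 1)).toLin'))) *
      (Nat.card F : ℝ) ^ (2 * Module.finrank F (LinearMap.ker (A - 1).toLin') - 1) := by
  have hdim := LinearMap.finrank_ker_inf_range (A - 1).toLin'
  rw [← toLin'_mul] at hdim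
  rw [card_fixedPairs]
  generalize Module.finrank F (LinearMap.ker (A - 1).toLin') = d₁ at *
  generalize Module.finrank F (LinearMap.ker ((A - 1) * (A - 1)).toLin') = d₂ at *
  generalize Module.finrank F (LinearMap.ker (A - 1).toLin' ⊓ LinearMap.range (A - 1).toLin' :
    Submodule F (ι → F)) = e at *
  obtain ⟨k, rfl⟩ : ∃ k, d₁ = e + k + 1 := ⟨d₁ - e - 1, by omega⟩
  have hq : (Nat.card F : ℝ) ≠ 0 := by exact_mod_cast Nat.card_pos.ne'
  rw [show 2 * (e + k + 1) - d₂ = k + 1 by omega,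
    show 2 * (e + k + 1) - 1 = (k + 1) + (e + (e + k)) by omega, Nat.add_sub_cancel,
    Nat.cast_mul, Nat.cast_sub (Nat.pow_le_pow_right Nat.card_pos (by omega))]
  push_cast
  rw [pow_add _ (k + 1), ← mul_assoc, sub_mul _ _ ((Nat.card F : ℝ) ^ (k + 1)), one_mul, ← mul_pow,
    inv_mul_cancel₀ hq]
  ring

end Matrix

namespace Matrix.GeneralLinearGroup

variable {F ι : Type*} [Field F] [Fintype ι] [DecidableEq ι]

/-- The action of an invertible matrix on vector-covector pairs. -/
def actPair (t : GL ι F) (p : (ι → F) × (ι → F)) : (ι → F) × (ι → F) :=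
  ((t : Matrix ι ι F) *ᵥ p.1, p.2 ᵥ* ((t⁻¹ : GL ι F) : Matrix ι ι F))

theorem actPair_mul (s t : GL ι F) (p : (ι → F) × (ι → F)) :
    actPair (s * t) p = actPair s (actPair t p) := by
  simp [actPair]

theorem actPair_one (p : (ι → F) × (ι → F)) : actPair (1 : GL ι F) p = p := by
  simp [actPair]

theorem actPair_eq_iff {t : GL ι F} {p p' : (ι → F) × (ι → F)} :
    actPair t p = p' ↔ p = actPair t⁻¹ p' := by
  constructor
  · rintro rfl
    rw [← actPair_mul, inv_mul_cancel, actPair_one]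
  · rintro rfl
    rw [← actPair_mul, mul_inv_cancel, actPair_one]

theorem vecMul_inv_eq_iff {t : GL ι F} {φ ψ : ι → F} :
    φ ᵥ* ((t⁻¹ : GL ι F) : Matrix ι ι F) = ψ ↔ ψ ᵥ* (t : Matrix ι ι F) = φ := by
  constructor <;>
  · rintro rfl
    rw [vecMul_vecMul, ← Units.val_mul]
    simp

theorem mem_fixedPairs_iff {g : GL ι F} {p : (ι → F) × (ι → F)} :
    p ∈ fixedPairs (g : Matrix ι ι F) ↔ actPair g p = p ∧ p.2 ⬝ᵥ p.1 = 1 := by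
  rw [actPair, Prod.ext_iff, vecMul_inv_eq_iff, and_assoc]
  rfl

theorem dotProduct_actPair (t : GL ι F) (p : (ι → F) × (ι → F)) :
    (actPair t p).2 ⬝ᵥ (actPair t p).1 = p.2 ⬝ᵥ p.1 := by
  rw [actPair, ← dotProduct_mulVec, mulVec_mulVec, ← Units.val_mul]
  simp

theorem actPair_mem_fixedPairs {g t : GL ι F} {p : (ι → F) × (ι → F)} :
    actPair t p ∈ fixedPairs (g : Matrix ι ι F) ↔
      p ∈ fixedPairs ((t⁻¹ * g * t : GL ι F) : Matrix ι ι F) := by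
  rw [mem_fixedPairs_iff, mem_fixedPairs_iff, dotProduct_actPair, mul_assoc, actPair_mul,
    actPair_mul, eq_comm (b := p), ← actPair_eq_iff, eq_comm (b := actPair g _)]

theorem exists_commute_actPair_eq (g : GL ι F) {p p' : (ι → F) × (ι → F)}
    (hp : p ∈ fixedPairs (g : Matrix ι ι F)) (hp' : p' ∈ fixedPairs (g : Matrix ι ι F)) :
    ∃ c : GL ι F, c * g = g * c ∧ actPair c p = p' := by
  obtain ⟨c, hc, hv, hφ⟩ := exists_commute_of_mem_fixedPairs _ hp hp'
  exact ⟨c, Units.ext hc, Prod.ext hv (vecMul_inv_eq_iff.2 hφ)⟩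

theorem exists_actPair_eq {p p' : (ι → F) × (ι → F)} (hp : p.2 ⬝ᵥ p.1 = 1)
    (hp' : p'.2 ⬝ᵥ p'.1 = 1) : ∃ c : GL ι F, actPair c p = p' := by
  obtain ⟨c, -, hc⟩ := exists_commute_actPair_eq 1 (mem_fixedPairs_iff.2 ⟨actPair_one p, hp⟩)
    (mem_fixedPairs_iff.2 ⟨actPair_one p', hp'⟩)
  exact ⟨c, hc⟩

variable {H : Subgroup (GL ι F)} {p₀ : (ι → F) × (ι → F)}

theorem exists_conj_of_isConj (hp₀ : p₀.2 ⬝ᵥ p₀.1 = 1) (hH : ∀ g, g ∈ H ↔ actPair g p₀ = p₀)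
    {h₁ h₂ : GL ι F} (hc : IsConj h₁ h₂) (hh₁ : h₁ ∈ H) (hh₂ : h₂ ∈ H) :
    ∃ t ∈ H, t * h₁ * t⁻¹ = h₂ := by
  obtain ⟨t, rfl⟩ := isConj_iff.mp hc
  have h₁' : p₀ ∈ fixedPairs (h₁ : Matrix ι ι F) := mem_fixedPairs_iff.2 ⟨(hH _).1 hh₁, hp₀⟩
  have h₂' : actPair t⁻¹ p₀ ∈ fixedPairs (h₁ : Matrix ι ι F) := by
    rw [actPair_mem_fixedPairs, inv_inv]
    exact mem_fixedPairs_iff.2 ⟨(hH _).1 hh₂, hp₀⟩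
  obtain ⟨c, hcomm, hcp⟩ := exists_commute_actPair_eq h₁ h₁' h₂'
  refine ⟨t * c, (hH _).2 ?_, ?_⟩
  · rw [actPair_mul, hcp, ← actPair_mul, mul_inv_cancel, actPair_one]
  · rw [mul_assoc t c, hcomm]
    group

theorem card_conj_mem_eq [Finite F] (hp₀ : p₀.2 ⬝ᵥ p₀.1 = 1)
    (hH : ∀ g, g ∈ H ↔ actPair g p₀ = p₀) (g : GL ι F) :
    Nat.card {t : GL ι F // t⁻¹ * g * t ∈ H} =
      Nat.card (fixedPairs (g : Matrix ι ι F)) * Nat.card H := by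
  have key (t : GL ι F) : t⁻¹ * g * t ∈ H ↔ actPair t p₀ ∈ fixedPairs (g : Matrix ι ι F) := by
    rw [actPair_mem_fixedPairs, mem_fixedPairs_iff, hH, and_iff_left hp₀]
  refine Nat.card_eq_card_mul_of_card_fiber_eq (fun t => ⟨actPair t.1 p₀, (key _).1 t.2⟩) _ ?_
  rintro ⟨p, hp⟩
  obtain ⟨c, rfl⟩ := exists_actPair_eq hp₀ (mem_fixedPairs_iff.1 hp).2
  exact Nat.card_congr
    { toFun := fun t => ⟨c⁻¹ * t.1.1, (hH _).2 <| by
        rw [actPair_mul, show actPair t.1.1 p₀ = actPair c p₀ from congrArg Subtype.val t.2,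
          ← actPair_mul, inv_mul_cancel, actPair_one]⟩
      invFun := fun h =>
        have hch : actPair (c * h.1) p₀ = actPair c p₀ := by rw [actPair_mul, (hH _).1 h.2]
        ⟨⟨c * h.1, (key _).2 (hch ▸ hp)⟩, Subtype.ext hch⟩
      left_inv := fun t => by simp
      right_inv := fun h => by simp }

end Matrix.GeneralLinearGroup

/-- For `G = GL(n,q)`, `H = GL(n−1,q)` embedded block-diagonally: if the partition
`λ_{z−1}(g)` attached to the polynomial `z−1` has at least one part of size `1`
(expressed intrinsically: `m₁ = 2·dim ker(g−1) − dim ker(g−1)² ≥ 1`), then `g^G ∩ H` is a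
single `H`-conjugacy class and
`|g^G ∩ H|/|g^G| = (|H|/|G|)·(1 − q^{−m₁})·q^{2λ'₁−1}`, where `λ'₁ = dim ker(g−1)` is the
number of parts of `λ_{z−1}(g)`. -/
theorem stmt10 {F : Type*} [Field F] [Fintype F] [DecidableEq F]
    (n : ℕ) (hn : 2 ≤ n) (i0 : Fin n) (hi0 : (i0 : ℕ) = n - 1)
    (H : Subgroup (GL (Fin n) F))
    (hH : ∀ g : GL (Fin n) F, g ∈ H ↔
      (∀ i : Fin n, (g : Matrix (Fin n) (Fin n) F) i i0 = if i = i0 then 1 else 0) ∧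
      (∀ j : Fin n, (g : Matrix (Fin n) (Fin n) F) i0 j = if j = i0 then 1 else 0))
    (g : GL (Fin n) F)
    (d1 d2 : ℕ)
    (hd1 : d1 = Module.finrank F
      (LinearMap.ker (Matrix.toLin' ((g : Matrix (Fin n) (Fin n) F) - 1))))
    (hd2 : d2 = Module.finrank F
      (LinearMap.ker (Matrix.toLin'
        (((g : Matrix (Fin n) (Fin n) F) - 1) * ((g : Matrix (Fin n) (Fin n) F) - 1)))))
    (hm1 : d2 < 2 * d1) :
    (∀ h₁ h₂ : GL (Fin n) F, IsConj g h₁ → h₁ ∈ H → IsConj g h₂ → h₂ ∈ H →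
      ∃ t ∈ H, t * h₁ * t⁻¹ = h₂) ∧
    (Nat.card {h : GL (Fin n) F // IsConj g h ∧ h ∈ H} : ℝ) /
        (Nat.card {h : GL (Fin n) F // IsConj g h} : ℝ) =
      (Nat.card H : ℝ) / (Nat.card (GL (Fin n) F) : ℝ) *
        (1 - ((Fintype.card F : ℝ))⁻¹ ^ (2 * d1 - d2)) *
        (Fintype.card F : ℝ) ^ (2 * d1 - 1) := by
  set p₀ : (Fin n → F) × (Fin n → F) := (Pi.single i0 1, Pi.single i0 1)
  have hp₀ : p₀.2 ⬝ᵥ p₀.1 = 1 := by simp [p₀]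
  have hHp (g : GL (Fin n) F) : g ∈ H ↔ GeneralLinearGroup.actPair g p₀ = p₀ := by
    rw [← and_iff_left (a := GeneralLinearGroup.actPair g p₀ = p₀) hp₀,
      ← GeneralLinearGroup.mem_fixedPairs_iff, hH]
    simp [p₀, fixedPairs, funext_iff, Pi.single_apply]
  refine ⟨fun h₁ h₂ hc₁ hh₁ hc₂ hh₂ =>
    GeneralLinearGroup.exists_conj_of_isConj hp₀ hHp (hc₁.symm.trans hc₂) hh₁ hh₂, ?_⟩
  have hcount := card_conj_eq_card_isConj_mul_card_centralizer (· ∈ H) g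
  rw [GeneralLinearGroup.card_conj_mem_eq hp₀ hHp] at hcount
  have hclass := card_conj_eq_card_isConj_mul_card_centralizer (fun _ => True) g
  simp only [and_true] at hclass
  rw [Nat.card_congr (Equiv.subtypeUnivEquiv fun _ => trivial)] at hclass
  have hG : (Nat.card (GL (Fin n) F) : ℝ) ≠ 0 := by exact_mod_cast Nat.card_pos.ne'
  have hY : (Nat.card {h : GL (Fin n) F // IsConj g h} : ℝ) ≠ 0 := by
    intro h
    rw [hclass, Nat.cast_mul, h, zero_mul] at hG
    exact hG rfl
  subst hd1 hd2
  rw [mul_assoc, ← Nat.card_eq_fintype_card, ← cast_card_fixedPairs _ hm1, div_mul_eq_mul_div,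
    div_eq_div_iff hY hG, hclass, mul_comm (Nat.card H : ℝ)]
  push_cast
  rw [mul_left_comm, mul_comm]
  exact_mod_cast congrArg (· * Nat.card {h : GL (Fin n) F // IsConj g h}) hcount.symm
end

section
/- Let g ∈ S_n have n_i cycles of length i, and let μ = (μ₁,…,μ_k) be a composition of n with associated Young subgroup S_μ. Then |g^{S_n} ∩ S_μ|/|g^{S_n}| = (Π_i i^{n_i} n_i!/n!) · Σ Π_k μ_k!/(Π_i i^{a_i^{(k)}} a_i^{(k)}!), where the sum is over all arrays of nonnegative integers a_i^{(k)} with Σ_k a_i^{(k)} = n_i for all i and Σ_i i·a_i^{(k)} = μ_k for all k. -/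
open scoped Classical

/-- The number of cycles of length `i` of a permutation (including fixed points as
cycles of length `1`). -/
noncomputable def numCycles {n : ℕ} (g : Equiv.Perm (Fin n)) (i : ℕ) : ℕ :=
  if i = 1 then (Finset.univ.filter fun x => g x = x).card else g.cycleType.count i

/-- The number of `i`-cycles of a permutation of a finite type, fixed points being `1`-cycles. -/
noncomputable def cycleCount {α : Type*} [Fintype α] [DecidableEq α]
    (σ : Equiv.Perm α) (i : ℕ) : ℕ :=
  if i = 1 then (Finset.univ.filter fun x => σ x = x).card else σ.cycleType.count i

section CycleCount

open Equiv Function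

theorem minimalPeriod_perm_pos {α : Type*} [Finite α] (σ : Perm α) (x : α) :
    0 < minimalPeriod σ x :=
  minimalPeriod_pos_of_mem_periodicPts (σ.injective.mem_periodicPts x)

variable {α : Type*} [Fintype α] [DecidableEq α]

theorem numCycles_eq_cycleCount {n : ℕ} (g : Perm (Fin n)) (i : ℕ) :
    numCycles g i = cycleCount g i := rfl

theorem minimalPeriod_eq_card_support_cycleOf (σ : Perm α) {x : α} (hx : σ x ≠ x) :
    minimalPeriod σ x = (σ.cycleOf x).support.card := by
  have hc := Perm.isCycle_cycleOf σ hx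
  have key (n : ℕ) : IsPeriodicPt σ n x ↔ (σ.cycleOf x).support.card ∣ n := by
    rw [← hc.orderOf, orderOf_dvd_iff_pow_eq_one,
      hc.pow_eq_one_iff' (x := x) (by rwa [Perm.cycleOf_apply_self]),
      Perm.cycleOf_pow_apply_self, IsPeriodicPt, IsFixedPt, Perm.iterate_eq_pow]
  refine Nat.dvd_antisymm ?_ ((key _).1 (isPeriodicPt_minimalPeriod _ _))
  exact ((key _).2 dvd_rfl).minimalPeriod_dvd

theorem card_minimalPeriod_eq (σ : Perm α) (i : ℕ) :
    (Finset.univ.filter fun x => minimalPeriod σ x = i).card = i * cycleCount σ i := by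
  by_cases h1 : i = 1
  · simp [cycleCount, h1, minimalPeriod_eq_one_iff_isFixedPt, IsFixedPt]
  have hmem {x : α} (hx : minimalPeriod σ x = i) : σ x ≠ x := fun h =>
    h1 (hx ▸ minimalPeriod_eq_one_iff_isFixedPt.2 h)
  rw [cycleCount, if_neg h1, Perm.cycleType_def, Multiset.count_map, mul_comm]
  have hcard : (σ.cycleFactorsFinset.filter fun τ => i = τ.support.card).card =
      (Multiset.filter (fun τ => i = (Finset.card ∘ Perm.support) τ)
        σ.cycleFactorsFinset.val).card := rfl
  rw [← hcard, Finset.card_eq_sum_card_fiberwise (f := σ.cycleOf)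
    (t := σ.cycleFactorsFinset.filter fun τ => i = τ.support.card), Finset.sum_const_nat]
  · intro τ hτ
    rw [Finset.mem_filter] at hτ
    obtain ⟨hτ, hi'⟩ := hτ
    rw [hi']
    congr 1
    ext x
    simp only [Finset.mem_filter, Finset.mem_univ, true_and]
    constructor
    · rintro ⟨hx, rfl⟩
      rw [Perm.mem_support, Perm.cycleOf_apply_self]
      exact hmem (hx.trans hi'.symm)
    · intro hx
      have h := Perm.cycle_is_cycleOf hx hτ
      have hx' : σ x ≠ x := Perm.mem_support.1 (Perm.mem_cycleFactorsFinset_support_le hτ hx)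
      exact ⟨by rw [minimalPeriod_eq_card_support_cycleOf σ hx', ← h], h.symm⟩
  · intro x hx
    simp only [Finset.coe_filter, Finset.mem_univ, true_and, Set.mem_ofPred_eq] at hx ⊢
    exact ⟨Perm.cycleOf_mem_cycleFactorsFinset_iff.2 (Perm.mem_support.2 (hmem hx)),
      by rw [← minimalPeriod_eq_card_support_cycleOf σ (hmem hx), hx]⟩

theorem sum_mul_cycleCount (σ : Perm α) {n : ℕ} (hn : Fintype.card α ≤ n) :
    ∑ i ∈ Finset.range n, (i + 1) * cycleCount σ (i + 1) = Fintype.card α := by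
  rw [← Finset.card_univ, Finset.card_eq_sum_card_fiberwise (f := fun x => minimalPeriod σ x - 1)
    (t := Finset.range n)]
  · refine Finset.sum_congr rfl fun i _ => ?_
    rw [← card_minimalPeriod_eq σ (i + 1)]
    congr 1
    ext x
    have := minimalPeriod_perm_pos σ x
    simp only [Finset.mem_filter, Finset.mem_univ, true_and]
    omega
  · intro x _
    have h1 := minimalPeriod_perm_pos σ x
    have h2 : minimalPeriod σ x ≤ Fintype.card α := minimalPeriod_le_card
    simp only [Finset.coe_range, Set.mem_Iio]
    omega

theorem cycleCount_eq_sum_fiber {ι : Type*} [Fintype ι] [DecidableEq ι] (c : α → ι) (σ : Perm α)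
    (τ : ∀ j, Perm {x // c x = j}) (h : ∀ j x, (τ j x : α) = σ x) {i : ℕ} (hi : i ≠ 0) :
    cycleCount σ i = ∑ j, cycleCount (τ j) i := by
  apply Nat.eq_of_mul_eq_mul_left (Nat.pos_of_ne_zero hi)
  rw [← card_minimalPeriod_eq σ i, Finset.mul_sum,
    Finset.card_eq_sum_card_fiberwise (f := c) (t := Finset.univ) (fun _ _ => by simp)]
  refine Finset.sum_congr rfl fun j _ => ?_
  rw [← card_minimalPeriod_eq (τ j) i]
  have hper (x : {x // c x = j}) : minimalPeriod (τ j) x = minimalPeriod σ x := by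
    refine minimalPeriod_eq_minimalPeriod_iff.2 fun n => ?_
    have hs : Semiconj (Subtype.val : {x // c x = j} → α) (τ j) σ := fun x => h j x
    rw [IsPeriodicPt, IsPeriodicPt, IsFixedPt, IsFixedPt, ← (hs.iterate_right n).eq,
      Subtype.val_inj]
  refine (Finset.card_bij (fun x _ => x.1) ?_ ?_ ?_).symm
  · intro x hx
    simpa [hper, x.2] using hx
  · exact fun _ _ _ _ h => Subtype.ext h
  · intro x hx
    simp only [Finset.mem_filter, Finset.mem_univ, true_and] at hx
    exact ⟨⟨x, hx.2⟩, by simp [hper, hx.1], rfl⟩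

/-- The cycle type of a permutation having `b i` cycles of length `i + 1` for `i ≤ n`. -/
def cycleTypeOfCounts (b : ℕ → ℕ) (n : ℕ) : Multiset ℕ :=
  ∑ i ∈ Finset.range n, Multiset.replicate (b (i + 1)) (i + 2)

theorem count_cycleTypeOfCounts (b : ℕ → ℕ) (n k : ℕ) :
    (cycleTypeOfCounts b n).count (k + 2) = if k < n then b (k + 1) else 0 := by
  simp [cycleTypeOfCounts, Multiset.count_sum', Multiset.count_replicate]

theorem two_le_of_mem_cycleTypeOfCounts {b : ℕ → ℕ} {n k : ℕ} (hk : k ∈ cycleTypeOfCounts b n) :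
    2 ≤ k := by
  obtain ⟨i, -, hi⟩ := Multiset.mem_sum.1 hk
  rw [Multiset.eq_of_mem_replicate hi]
  omega

theorem sum_cycleTypeOfCounts (b : ℕ → ℕ) (n : ℕ) :
    (cycleTypeOfCounts b n).sum = ∑ i ∈ Finset.range n, (i + 2) * b (i + 1) := by
  rw [cycleTypeOfCounts, ← Multiset.coe_sumAddMonoidHom, map_sum]
  simp [mul_comm]

theorem prod_cycleTypeOfCounts (b : ℕ → ℕ) (n : ℕ) :
    (cycleTypeOfCounts b n).prod = ∏ i ∈ Finset.range n, (i + 2) ^ b (i + 1) := by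
  rw [cycleTypeOfCounts, Multiset.prod_sum]
  simp

theorem prod_factorial_count_cycleTypeOfCounts (b : ℕ → ℕ) (n : ℕ) :
    ∏ k ∈ (cycleTypeOfCounts b n).toFinset, ((cycleTypeOfCounts b n).count k).factorial =
      ∏ i ∈ Finset.range n, (b (i + 1)).factorial := by
  have himg : ∏ i ∈ Finset.range n, (b (i + 1)).factorial =
      ∏ k ∈ (Finset.range n).image (· + 2), ((cycleTypeOfCounts b n).count k).factorial := by
    rw [Finset.prod_image (by simp)]
    refine Finset.prod_congr rfl fun i hi => ?_
    rw [count_cycleTypeOfCounts, if_pos (Finset.mem_range.1 hi)]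
  rw [himg]
  refine Finset.prod_subset (fun k hk => ?_) fun k _ hk => ?_
  · obtain ⟨i, hi, hik⟩ := Multiset.mem_sum.1 (Multiset.mem_toFinset.1 hk)
    exact Finset.mem_image.2 ⟨i, hi, (Multiset.eq_of_mem_replicate hik).symm⟩
  · rw [Multiset.mem_toFinset] at hk
    rw [Multiset.count_eq_zero_of_notMem hk, Nat.factorial_zero]

theorem forall_cycleCount_eq_iff (σ : Perm α) (b : ℕ → ℕ) (n : ℕ)
    (hb : ∑ i ∈ Finset.range (n + 1), (i + 1) * b i = Fintype.card α)
    (hn : Fintype.card α ≤ n + 1) :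
    (∀ i < n + 1, cycleCount σ (i + 1) = b i) ↔ σ.cycleType = cycleTypeOfCounts b n := by
  constructor
  · intro h
    ext k
    rcases lt_or_ge k 2 with hk | hk
    · rw [Multiset.count_eq_zero_of_notMem fun hm => ?_,
        Multiset.count_eq_zero_of_notMem fun hm => ?_]
      · exact hk.not_ge (two_le_of_mem_cycleTypeOfCounts hm)
      · exact hk.not_ge (Perm.two_le_of_mem_cycleType hm)
    obtain ⟨k, rfl⟩ := Nat.exists_eq_add_of_le' hk
    rw [count_cycleTypeOfCounts]
    split_ifs with hkn
    · rw [← h (k + 1) (by omega), cycleCount, if_neg (by omega)]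
    · refine Multiset.count_eq_zero_of_notMem fun hm => ?_
      have h1 := Multiset.le_sum_of_mem hm
      have h2 := σ.sum_cycleType_le
      omega
  · intro h
    rintro (_ | i) hi
    · have h1 := sum_mul_cycleCount σ hn
      rw [← hb, Finset.sum_range_succ', Finset.sum_range_succ'] at h1
      have h2 : ∑ i ∈ Finset.range n, (i + 1 + 1) * cycleCount σ (i + 1 + 1) =
          ∑ i ∈ Finset.range n, (i + 1 + 1) * b (i + 1) := by
        refine Finset.sum_congr rfl fun i hi => ?_
        rw [cycleCount, if_neg (by omega), h, count_cycleTypeOfCounts,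
          if_pos (Finset.mem_range.1 hi)]
      omega
    · rw [cycleCount, if_neg (by omega), h, count_cycleTypeOfCounts, if_pos (by omega)]

theorem card_cycleCount_eq_mul (b : ℕ → ℕ) (n : ℕ)
    (hb : ∑ i ∈ Finset.range n, (i + 1) * b i = Fintype.card α) (hn : Fintype.card α ≤ n) :
    (Finset.univ.filter fun σ : Perm α => ∀ i < n, cycleCount σ (i + 1) = b i).card *
      ∏ i ∈ Finset.range n, ((i + 1) ^ b i * (b i).factorial) = (Fintype.card α).factorial := by
  rcases n with _ | n
  · have : IsEmpty α := Fintype.card_eq_zero_iff.1 (by omega)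
    simp
  simp only [forall_cycleCount_eq_iff _ b n hb hn]
  have hsum := sum_cycleTypeOfCounts b n
  rw [Finset.sum_range_succ'] at hb
  simp only [add_assoc, Nat.reduceAdd, zero_add, one_mul] at hb
  have h := Perm.card_of_cycleType_mul_eq α (cycleTypeOfCounts b n)
  rw [if_pos ⟨by rw [hsum]; omega, fun a => two_le_of_mem_cycleTypeOfCounts⟩,
    prod_factorial_count_cycleTypeOfCounts, prod_cycleTypeOfCounts,
    show Fintype.card α - (cycleTypeOfCounts b n).sum = b 0 by rw [hsum]; omega] at h
  rw [← h, Finset.prod_range_succ', Finset.prod_mul_distrib]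
  ring

theorem isConj_iff_forall_cycleCount_eq (σ τ : Perm α) {n : ℕ} (hn : Fintype.card α ≤ n) :
    IsConj σ τ ↔ ∀ i < n, cycleCount τ (i + 1) = cycleCount σ (i + 1) := by
  rcases n with _ | n
  · have : IsEmpty α := Fintype.card_eq_zero_iff.1 (by omega)
    simp [Subsingleton.elim σ τ, IsConj.refl τ, -isConj_iff]
  have hs := sum_mul_cycleCount σ hn
  rw [forall_cycleCount_eq_iff τ (fun i => cycleCount σ (i + 1)) n hs hn,
    ← (forall_cycleCount_eq_iff σ (fun i => cycleCount σ (i + 1)) n hs hn).1 fun _ _ => rfl,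
    Perm.isConj_iff_cycleType_eq, eq_comm]

/-- Permutations preserving every fiber of `c` are families of permutations of the fibers. -/
def permPreservingEquivPi {ι : Type*} (c : α → ι) :
    {σ : Perm α // ∀ x, c (σ x) = c x} ≃ ∀ j, Perm {x // c x = j} where
  toFun σ j := σ.1.subtypePerm fun x => by rw [σ.2 x]
  invFun τ := ⟨DomMulAct.stabilizerEquiv_invFun_aux τ, DomMulAct.comp_stabilizerEquiv_invFun τ⟩
  left_inv _ := rfl
  right_inv τ := by
    ext j ⟨x, rfl⟩
    rfl

theorem card_forall_cycleCount_eq_mul {n : ℕ} (b : Fin n → ℕ)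
    (hb : ∑ i : Fin n, ((i : ℕ) + 1) * b i = Fintype.card α) (hn : Fintype.card α ≤ n) :
    (Finset.univ.filter fun σ : Perm α => ∀ i : Fin n, cycleCount σ (i + 1) = b i).card *
      ∏ i : Fin n, (((i : ℕ) + 1) ^ b i * (b i).factorial) = (Fintype.card α).factorial := by
  set b' : ℕ → ℕ := fun i => if h : i < n then b ⟨i, h⟩ else 0
  have hb' (i : Fin n) : b i = b' i := by simp [b']
  simp only [hb'] at hb ⊢
  rw [← card_cycleCount_eq_mul b' n
    (by rw [← hb, Fin.sum_univ_eq_sum_range fun i => (i + 1) * b' i]) hn,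
    Fin.prod_univ_eq_prod_range fun i => (i + 1) ^ b' i * (b' i).factorial]
  simp only [Fin.forall_iff]

theorem sum_fin_mul_cycleCount (σ : Perm α) {n : ℕ} (hn : Fintype.card α ≤ n) :
    ∑ i : Fin n, ((i : ℕ) + 1) * cycleCount σ (i + 1) = Fintype.card α := by
  rw [← sum_mul_cycleCount σ hn,
    Fin.sum_univ_eq_sum_range fun i => (i + 1) * cycleCount σ (i + 1)]

theorem cycleCount_le_card (σ : Perm α) {i : ℕ} (hi : i ≠ 0) :
    cycleCount σ i ≤ Fintype.card α :=
  (Nat.le_mul_of_pos_left _ (Nat.pos_of_ne_zero hi)).trans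
    (card_minimalPeriod_eq σ i ▸ Finset.card_le_univ _)

theorem card_cycleCount_eq_preserving {ι : Type*} [Fintype ι] [DecidableEq ι] (c : α → ι) {n : ℕ}
    (N : Fin n → ℕ) :
    Nat.card {σ : Perm α // (∀ i : Fin n, cycleCount σ (i + 1) = N i) ∧ ∀ x, c (σ x) = c x} =
      Nat.card {τ : ∀ j, Perm {x // c x = j} //
        ∀ i : Fin n, ∑ j, cycleCount (τ j) (i + 1) = N i} := by
  refine Nat.card_congr (((Equiv.subtypeEquivRight fun _ => and_comm).trans
    (Equiv.subtypeSubtypeEquivSubtypeInter _ _).symm).trans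
    ((permPreservingEquivPi c).subtypeEquiv fun σ => forall_congr' fun i => ?_))
  rw [cycleCount_eq_sum_fiber c σ.1 (permPreservingEquivPi c σ) (fun _ _ => rfl)
    i.1.succ_ne_zero]

theorem card_fiberwise_cycleCount_eq {ι : Type*} [Fintype ι] [DecidableEq ι] (c : α → ι) {n : ℕ}
    (hn : Fintype.card α ≤ n) (N : Fin n → ℕ) :
    Nat.card {σ : Perm α // (∀ i : Fin n, cycleCount σ (i + 1) = N i) ∧ ∀ x, c (σ x) = c x} =
      ∑ a ∈ Finset.univ.filter (fun a : ι → Fin n → Fin (n + 1) =>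
          (∀ i : Fin n, ∑ j, (a j i : ℕ) = N i) ∧
          ∀ j, ∑ i : Fin n, ((i : ℕ) + 1) * (a j i : ℕ) = Fintype.card {x // c x = j}),
        ∏ j, (Finset.univ.filter fun σ : Perm {x // c x = j} =>
          ∀ i : Fin n, cycleCount σ (i + 1) = a j i).card := by
  have hfib (j : ι) : Fintype.card {x // c x = j} ≤ n := (Fintype.card_subtype_le _).trans hn
  let counts (τ : ∀ j, Perm {x // c x = j}) (j : ι) (i : Fin n) : Fin (n + 1) :=
    ⟨cycleCount (τ j) (i + 1),
      Nat.lt_succ_of_le ((cycleCount_le_card (τ j) i.1.succ_ne_zero).trans (hfib j))⟩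
  rw [card_cycleCount_eq_preserving, Nat.card_eq_fintype_card, Fintype.card_subtype,
    Finset.card_eq_sum_card_fiberwise (f := counts)]
  · refine Finset.sum_congr rfl fun a ha => ?_
    rw [← Fintype.card_piFinset]
    congr 1
    ext τ
    simp only [Finset.mem_filter, Finset.mem_univ, true_and, Fintype.mem_piFinset, funext_iff,
      Fin.ext_iff, counts] at ha ⊢
    refine ⟨And.right, fun h => ⟨fun i => ?_, h⟩⟩
    simp only [h, ha.1 i]
  · intro τ hτ
    rw [Finset.mem_coe, Finset.mem_filter] at hτ ⊢
    exact ⟨Finset.mem_univ _, hτ.2, fun j => sum_fin_mul_cycleCount (τ j) (hfib j)⟩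

end CycleCount

/-- `|g^{S_n} ∩ S_μ|/|g^{S_n}|` equals
`(Π_i i^{n_i} n_i!/n!)·Σ_a Π_k μ_k!/(Π_i i^{a_i^{(k)}} a_i^{(k)}!)`, the sum being over
arrays `a` with `Σ_k a_i^{(k)} = n_i` and `Σ_i i·a_i^{(k)} = μ_k`. -/
theorem stmt17 (n K : ℕ) (g : Equiv.Perm (Fin n)) (μ : Fin K → ℕ) (hμ : ∑ j, μ j = n)
    (c : Fin n → Fin K)
    (hc : ∀ j, (Finset.univ.filter fun i => c i = j).card = μ j) :
    (Nat.card {h : Equiv.Perm (Fin n) // IsConj g h ∧ ∀ i, c (h i) = c i} : ℝ) /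
        (Nat.card {h : Equiv.Perm (Fin n) // IsConj g h} : ℝ) =
      ((∏ i : Fin n, (((i : ℕ) + 1) ^ numCycles g ((i : ℕ) + 1) *
          (numCycles g ((i : ℕ) + 1)).factorial) : ℕ) : ℝ) / (n.factorial : ℝ) *
        ∑ a ∈ Finset.univ.filter (fun a : Fin K → Fin n → Fin (n + 1) =>
            (∀ i : Fin n, ∑ j : Fin K, (a j i : ℕ) = numCycles g ((i : ℕ) + 1)) ∧
            (∀ j : Fin K, ∑ i : Fin n, ((i : ℕ) + 1) * (a j i : ℕ) = μ j)),
          ∏ j : Fin K, ((μ j).factorial : ℝ) /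
            ((∏ i : Fin n, (((i : ℕ) + 1) ^ (a j i : ℕ) * (a j i : ℕ).factorial) : ℕ) : ℝ) := by
  simp only [numCycles_eq_cycleCount]
  have hcard : Fintype.card (Fin n) ≤ n := (Fintype.card_fin n).le
  have hfib (j : Fin K) : Fintype.card {x // c x = j} = μ j := by
    rw [Fintype.card_subtype, ← hc j]
  have hiff (h : Equiv.Perm (Fin n)) :
      IsConj g h ↔ ∀ i : Fin n, cycleCount h (i + 1) = cycleCount g (i + 1) := by
    rw [isConj_iff_forall_cycleCount_eq g h hcard, Fin.forall_iff]
  have hclass := card_forall_cycleCount_eq_mul (α := Fin n) (n := n)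
    (fun i => cycleCount g (i + 1)) (sum_fin_mul_cycleCount g hcard) hcard
  rw [Fintype.card_fin] at hclass
  simp only [hiff]
  rw [card_fiberwise_cycleCount_eq c hcard, Nat.card_eq_fintype_card, Fintype.card_subtype]
  simp only [hfib]
  set P := ∏ i : Fin n, (((i : ℕ) + 1) ^ cycleCount g (i + 1) *
    (cycleCount g (i + 1)).factorial) with hP
  have hPpos : P ≠ 0 := Finset.prod_ne_zero_iff.2 fun i _ => by positivity
  have hPR : (P : ℝ) ≠ 0 := Nat.cast_ne_zero.2 hPpos
  rw [← hclass]
  have hC := left_ne_zero_of_mul (hclass.trans_ne n.factorial_ne_zero)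
  rw [Nat.cast_mul, div_mul_cancel_right₀ hPR, div_eq_inv_mul, Nat.cast_sum]
  congr 1
  refine Finset.sum_congr rfl fun a ha => ?_
  rw [Nat.cast_prod]
  refine Finset.prod_congr rfl fun j _ => ?_
  have hj := card_forall_cycleCount_eq_mul (α := {x // c x = j}) (fun i => (a j i : ℕ))
    (by rw [hfib]; exact (Finset.mem_filter.1 ha).2.2 j)
    ((Fintype.card_subtype_le _).trans hcard)
  rw [hfib] at hj
  rw [← hj, Nat.cast_mul, mul_div_cancel_right₀]
  exact Nat.cast_ne_zero.2 (Finset.prod_ne_zero_iff.2 fun i _ => by positivity)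
end
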